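/- Fix d ≥ 1. For polynomials γ, c ∈ ℤ[t], let φ_{(γ,c)}(x) = (x − γ)² + c, viewed as a quadratic polynomial over K = ℚ(t), and call the pair (γ, c) surjective if for every n ≥ 1 the splitting field of φ_{(γ,c)}^n over ℚ(t) has degree 2^{2^n − 1} over ℚ(t). For B ≥ 0 let P_d(B) = { f ∈ ℤ[t] : deg f ≤ d and every coefficient of f has absolute value at most B }, and let Sur_d(B) = { (γ, c) ∈ P_d(B) × P_d(B) : (γ, c) is surjective }. Then there exists a constant C > 0 such that for all integers B ≥ 2, | #Sur_d(B) − (2B+1)^{2d+2} | ≤ C · B^{2d + 3/2} · log B. -/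

import Mathlib

open Polynomial

/-- The `n`-fold iterate `φ^n` of a polynomial under composition (`φ^0 = x`). -/
noncomputable def polyIter {R : Type*} [CommRing R] (φ : Polynomial R) : ℕ → Polynomial R
  | 0 => Polynomial.X
  | n + 1 => φ.comp (polyIter φ n)

/-- The quadratic polynomial `φ_{(γ,c)}(x) = (x - γ)² + c` over `ℚ(t)` attached to a pair
`γ, c ∈ ℤ[t]`. -/
noncomputable def phiPair (γ c : Polynomial ℤ) : Polynomial (RatFunc ℚ) :=
  (X - C (algebraMap (Polynomial ℚ) (RatFunc ℚ) (γ.map (Int.castRingHom ℚ)))) ^ 2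
    + C (algebraMap (Polynomial ℚ) (RatFunc ℚ) (c.map (Int.castRingHom ℚ)))

/-- A pair `(γ, c)` is surjective if for every `n ≥ 1` the splitting field of
`φ_{(γ,c)}^n` over `ℚ(t)` has degree `2^{2^n - 1}`: the arboreal representation of
`φ_{(γ,c)}` is surjective onto `Aut(T_2)`. -/
def IsSurjPair (γ c : Polynomial ℤ) : Prop :=
  ∀ n : ℕ, 1 ≤ n →
    Module.finrank (RatFunc ℚ) ((polyIter (phiPair γ c) n).SplittingField) = 2 ^ (2 ^ n - 1)

/-- `Sur_d(B)`: the set of pairs `(γ, c) ∈ P_d(B) × P_d(B)` (integer polynomials of degree at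
most `d` with coefficients of absolute value at most `B`) that are surjective. -/
def SurSet (d B : ℕ) : Set (Polynomial ℤ × Polynomial ℤ) :=
  {pc | pc.1.natDegree ≤ d ∧ pc.2.natDegree ≤ d ∧
    (∀ i, |pc.1.coeff i| ≤ (B : ℤ)) ∧ (∀ i, |pc.2.coeff i| ≤ (B : ℤ)) ∧
    IsSurjPair pc.1 pc.2}

set_option linter.style.haveILetI false

section partA
variable {K Ω : Type*} [Field K] [Field Ω] [Algebra K Ω]

/-- The explicit quadratic extension `F + F e`. -/
def quadExt (F : IntermediateField K Ω) (e : Ω) (he2 : e * e ∈ F) (he : e ∉ F) :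
    IntermediateField K Ω where
  carrier := {y | ∃ a ∈ F, ∃ b ∈ F, y = a + b * e}
  mul_mem' := by
    rintro _ _ ⟨a, ha, b, hb, rfl⟩ ⟨a', ha', b', hb', rfl⟩
    exact ⟨a * a' + b * b' * (e * e),
      F.add_mem (F.mul_mem ha ha') (F.mul_mem (F.mul_mem hb hb') he2),
      a * b' + b * a', F.add_mem (F.mul_mem ha hb') (F.mul_mem hb ha'), by ring⟩
  add_mem' := by
    rintro _ _ ⟨a, ha, b, hb, rfl⟩ ⟨a', ha', b', hb', rfl⟩
    exact ⟨a + a', F.add_mem ha ha', b + b', F.add_mem hb hb', by ring⟩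
  algebraMap_mem' := fun x => ⟨_, F.algebraMap_mem x, 0, F.zero_mem, by ring⟩
  inv_mem' := by
    rintro _ ⟨a, ha, b, hb, rfl⟩
    by_cases hb0 : b = 0
    · subst hb0
      exact ⟨a⁻¹, F.inv_mem ha, 0, F.zero_mem, by simp⟩
    · have hm : a - b * e ≠ 0 := by
        intro h
        apply he
        have : e = a / b := by field_simp; linear_combination -h
        rw [this]; exact F.div_mem ha hb
      have hp : a + b * e ≠ 0 := by
        intro h
        apply he
        have : e = -a / b := by field_simp; linear_combination h
        rw [this]; exact F.div_mem (F.neg_mem ha) hb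
      have hN : a * a - b * b * (e * e) ∈ F :=
        F.sub_mem (F.mul_mem ha ha) (F.mul_mem (F.mul_mem hb hb) he2)
      have hN0 : a * a - b * b * (e * e) ≠ 0 := by
        have : a * a - b * b * (e * e) = (a - b * e) * (a + b * e) := by ring
        rw [this]; exact mul_ne_zero hm hp
      refine ⟨a / (a * a - b * b * (e * e)), F.div_mem ha hN,
        -b / (a * a - b * b * (e * e)), F.div_mem (F.neg_mem hb) hN, ?_⟩
      rw [inv_eq_iff_eq_inv, eq_comm, inv_eq_iff_eq_inv]
      rw [eq_comm, inv_eq_of_mul_eq_one_right]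
      rw [div_mul_eq_mul_div, ← add_div, mul_div_assoc', div_eq_one_iff_eq hN0]
      ring

theorem quadExt_eq (F : IntermediateField K Ω) (e : Ω) (he2 : e * e ∈ F) (he : e ∉ F) :
    F ⊔ IntermediateField.adjoin K {e} = quadExt F e he2 he := by
  apply le_antisymm
  · refine sup_le ?_ ?_
    · intro x hx
      exact ⟨x, hx, 0, F.zero_mem, by ring⟩
    · rw [IntermediateField.adjoin_le_iff, Set.singleton_subset_iff]
      exact ⟨0, F.zero_mem, 1, F.one_mem, by ring⟩
  · rintro _ ⟨a, ha, b, hb, rfl⟩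
    have h1 : F ≤ F ⊔ IntermediateField.adjoin K {e} := le_sup_left
    have h2 : e ∈ F ⊔ IntermediateField.adjoin K {e} :=
      (le_sup_right : _ ≤ F ⊔ IntermediateField.adjoin K {e})
        (IntermediateField.mem_adjoin_simple_self K e)
    exact add_mem (h1 ha) (mul_mem (h1 hb) h2)

theorem finrank_quadExt (F : IntermediateField K Ω) [FiniteDimensional K F]
    (e : Ω) (he2 : e * e ∈ F) (he : e ∉ F) :
    Module.finrank K (F ⊔ IntermediateField.adjoin K {e} : IntermediateField K Ω)
      = 2 * Module.finrank K F := by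
  rw [quadExt_eq F e he2 he]
  let f : (F × F) →ₗ[K] quadExt F e he2 he :=
    { toFun := fun p => ⟨p.1 + p.2 * e, ⟨p.1, p.1.2, p.2, p.2.2, rfl⟩⟩
      map_add' := by
        intro p q; apply Subtype.ext
        change ((p.1 + q.1 : F) : Ω) + ((p.2 + q.2 : F) : Ω) * e = (p.1 + p.2 * e) + (q.1 + q.2 * e)
        push_cast; ring
      map_smul' := by
        intro m p; apply Subtype.ext
        change ((m • p.1 : F) : Ω) + ((m • p.2 : F) : Ω) * e = m • ((p.1 : Ω) + p.2 * e)
        simp [smul_add] }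
  have hf : Function.Bijective f := by
    constructor
    · rw [← LinearMap.ker_eq_bot, LinearMap.ker_eq_bot']
      rintro ⟨⟨a, ha⟩, ⟨b, hb⟩⟩ h
      have h' : a + b * e = 0 := congrArg Subtype.val h
      by_cases hb0 : b = 0
      · subst hb0
        have : a = 0 := by simpa using h'
        subst this
        rfl
      · exfalso; apply he
        have : e = -a / b := by field_simp; linear_combination h'
        rw [this]; exact F.div_mem (F.neg_mem ha) hb
    · rintro ⟨_, a, ha, b, hb, rfl⟩
      exact ⟨(⟨a, ha⟩, ⟨b, hb⟩), rfl⟩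
  rw [← (LinearEquiv.ofBijective f hf).finrank_eq, Module.finrank_prod]
  ring

theorem sq_descent [CharZero Ω] (F : IntermediateField K Ω) (e : Ω) (he2 : e * e ∈ F)
    (x : Ω) (y : Ω) (hy : y ∈ F ⊔ IntermediateField.adjoin K {e}) (hyx : y * y = x) (hx : x ∈ F) :
    ∃ z ∈ F, z * z = x ∨ z * z = x * (e * e) := by
  by_cases he : e ∈ F
  · have : F ⊔ IntermediateField.adjoin K {e} = F := by
      rw [sup_eq_left, IntermediateField.adjoin_le_iff, Set.singleton_subset_iff]; exact he
    rw [this] at hy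
    exact ⟨y, hy, Or.inl hyx⟩
  · rw [quadExt_eq F e he2 he] at hy
    obtain ⟨a, ha, b, hb, rfl⟩ := hy
    have hab : a * b = 0 := by
      by_contra h0
      apply he
      have h2 : (2 : Ω) * (a * b) ≠ 0 := mul_ne_zero two_ne_zero h0
      have : e = (x - a * a - b * b * (e * e)) / (2 * (a * b)) := by
        rw [eq_div_iff h2, ← hyx]; ring
      rw [this]
      refine F.div_mem (F.sub_mem (F.sub_mem hx (F.mul_mem ha ha))
        (F.mul_mem (F.mul_mem hb hb) he2)) (F.mul_mem ?_ (F.mul_mem ha hb))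
      exact ofNat_mem F 2
    rcases mul_eq_zero.1 hab with h | h
    · subst h
      exact ⟨b * (e * e), F.mul_mem hb he2, Or.inr (by rw [← hyx]; ring)⟩
    · subst h
      exact ⟨a, ha, Or.inl (by rw [← hyx]; ring)⟩

theorem kummer_insert {ι : Type*} [DecidableEq ι] (F : IntermediateField K Ω) (e : ι → Ω) (i : ι)
    (s : Finset ι) :
    F ⊔ IntermediateField.adjoin K (e '' (insert i s : Finset ι)) =
      (F ⊔ IntermediateField.adjoin K (e '' s)) ⊔ IntermediateField.adjoin K {e i} := by
  rw [Finset.coe_insert, Set.image_insert_eq, Set.insert_eq, IntermediateField.adjoin_union,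
    sup_assoc, sup_comm (IntermediateField.adjoin K {e i})]

theorem kummer_sq [CharZero Ω] {ι : Type*} [DecidableEq ι] (F : IntermediateField K Ω) (e : ι → Ω)
    (s : Finset ι) (he : ∀ i ∈ s, e i * e i ∈ F) :
    ∀ x ∈ F, ∀ y ∈ F ⊔ IntermediateField.adjoin K (e '' s), y * y = x →
      ∃ S ⊆ s, ∃ z ∈ F, z * z = x * ∏ i ∈ S, e i * e i := by
  induction s using Finset.induction_on with
  | empty =>
    intro x hx y hy hyx
    refine ⟨∅, le_rfl, y, ?_, by simpa using hyx⟩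
    simpa using hy
  | insert i s his ih =>
    intro x hx y hy hyx
    rw [kummer_insert] at hy
    have hle : F ≤ F ⊔ IntermediateField.adjoin K (e '' s) := le_sup_left
    have hei := he i (Finset.mem_insert_self _ _)
    have ih' := ih (fun j hj => he j (Finset.mem_insert_of_mem hj))
    obtain ⟨z, hz, h | h⟩ := sq_descent _ (e i) (hle hei) x y hy hyx (hle hx)
    · obtain ⟨S, hS, w, hw, h'⟩ := ih' x hx z hz h
      exact ⟨S, hS.trans (Finset.subset_insert _ _), w, hw, h'⟩
    · obtain ⟨S, hS, w, hw, h'⟩ := ih' _ (F.mul_mem hx hei) z hz h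
      refine ⟨insert i S, Finset.insert_subset_insert _ hS, w, hw, ?_⟩
      rw [h', Finset.prod_insert (fun h => his (hS h))]
      ring

theorem kummer_finrank [CharZero Ω] {ι : Type*} [DecidableEq ι] (F : IntermediateField K Ω)
    [FiniteDimensional K F] (e : ι → Ω)
    (s : Finset ι) (he : ∀ i ∈ s, e i * e i ∈ F)
    (hind : ∀ S ⊆ s, S.Nonempty → ¬ ∃ z ∈ F, z * z = ∏ i ∈ S, e i * e i) :
    Module.finrank K (F ⊔ IntermediateField.adjoin K (e '' s) : IntermediateField K Ω) =
      2 ^ s.card * Module.finrank K F := by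
  induction s using Finset.induction_on with
  | empty =>
    rw [Finset.coe_empty, Set.image_empty, IntermediateField.adjoin_empty, sup_bot_eq]
    simp
  | insert i s his ih =>
    have ih' := ih (fun j hj => he j (Finset.mem_insert_of_mem hj))
      (fun S hS => hind S (hS.trans (Finset.subset_insert _ _)))
    have hle : F ≤ F ⊔ IntermediateField.adjoin K (e '' s) := le_sup_left
    have hei := he i (Finset.mem_insert_self _ _)
    have hni : e i ∉ F ⊔ IntermediateField.adjoin K (e '' s) := by
      intro hmem
      obtain ⟨S, hS, w, hw, h'⟩ := kummer_sq F e s (fun j hj => he j (Finset.mem_insert_of_mem hj))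
        (e i * e i) hei (e i) hmem rfl
      refine hind (insert i S) (Finset.insert_subset_insert _ hS) (Finset.insert_nonempty _ _)
        ⟨w, hw, ?_⟩
      rw [h', Finset.prod_insert (fun h => his (hS h))]
    have : FiniteDimensional K (F ⊔ IntermediateField.adjoin K (e '' s) : IntermediateField K Ω) := by
      apply FiniteDimensional.of_finrank_pos
      rw [ih']
      have := Module.finrank_pos (R := K) (M := F)
      positivity
    rw [kummer_insert, finrank_quadExt _ (e i) (hle hei) hni, ih', Finset.card_insert_of_notMem his]
    ring

end partA

section partA4
variable {K L : Type*} [Field K] [Field L] [Algebra K L]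

theorem prod_symmDiff_mul {L : Type*} [Field L] [DecidableEq L] (D : L → L) (J J' : Finset L) :
    (∏ a ∈ symmDiff J J', D a) * ((∏ a ∈ J ∩ J', D a) * ∏ a ∈ J ∩ J', D a)
      = (∏ a ∈ J, D a) * ∏ a ∈ J', D a := by
  have h1 : ∏ a ∈ symmDiff J J', D a = (∏ a ∈ J \ J', D a) * ∏ a ∈ J' \ J, D a := by
    rw [symmDiff_def, Finset.sup_eq_union, Finset.prod_union disjoint_sdiff_sdiff]
  have h2 := Finset.prod_inter_mul_prod_sdiff J J' D
  have h3 := Finset.prod_inter_mul_prod_sdiff J' J D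
  rw [Finset.inter_comm] at h3
  rw [h1, ← h2, ← h3]; ring

theorem isSquare_symmDiff {L : Type*} [Field L] [DecidableEq L] (D : L → L) (J J' : Finset L)
    (h0 : ∀ a ∈ J, D a ≠ 0)
    (h : IsSquare ((∏ a ∈ J, D a) * ∏ a ∈ J', D a)) : IsSquare (∏ a ∈ symmDiff J J', D a) := by
  obtain ⟨y, hy⟩ := h
  rw [← prod_symmDiff_mul] at hy
  have hn : ∏ a ∈ J ∩ J', D a ≠ 0 :=
    Finset.prod_ne_zero_iff.2 (fun a ha => h0 a (Finset.mem_of_mem_inter_left ha))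
  refine ⟨y / ∏ a ∈ J ∩ J', D a, ?_⟩
  field_simp
  linear_combination hy

theorem fixed_or [DecidableEq L] (R : Finset L)
    (htr : ∀ α ∈ R, ∀ β ∈ R, ∃ σ : L ≃ₐ[K] L, σ α = β) (J : Finset L) (hJR : J ⊆ R)
    (hJ : J.Nonempty) (hfix : ∀ σ : L ≃ₐ[K] L, J.image σ = J) : J = R := by
  apply Finset.Subset.antisymm hJR
  intro β hβ
  obtain ⟨α, hα⟩ := hJ
  obtain ⟨σ, rfl⟩ := htr α (hJR hα) β hβ
  rw [← hfix σ]; exact Finset.mem_image_of_mem _ hα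

theorem exists_fixed [FiniteDimensional K L] [IsGalois K L] (k : ℕ)
    (hk : Module.finrank K L = 2 ^ k) (R : Finset L)
    (hR : ∀ σ : L ≃ₐ[K] L, ∀ α ∈ R, σ α ∈ R)
    (htr : ∀ α ∈ R, ∀ β ∈ R, ∃ σ : L ≃ₐ[K] L, σ α = β)
    (D : L → L) (hD : ∀ (σ : L ≃ₐ[K] L) x, D (σ x) = σ (D x))
    (J₀ : Finset L) (hJR : J₀ ⊆ R) (hJ : J₀.Nonempty) (hsq : IsSquare (∏ a ∈ J₀, D a)) :
    IsSquare (∏ a ∈ R, D a) := by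
  classical
  by_cases h0 : ∃ a ∈ R, D a = 0
  · obtain ⟨a, ha, h⟩ := h0
    rw [Finset.prod_eq_zero ha h]; exact IsSquare.zero
  push Not at h0
  let V := {J : Finset L // J ⊆ R ∧ IsSquare (∏ a ∈ J, D a)}
  have : Finite V := by
    apply Finite.of_injective (β := {J : Finset L // J ∈ R.powerset})
      (fun J => ⟨J.1, Finset.mem_powerset.2 J.2.1⟩)
    intro a b h; apply Subtype.ext; simpa using h
  let _ : MulAction (L ≃ₐ[K] L) V :=
    { smul := fun σ J => ⟨J.1.image σ, by
        intro x hx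
        obtain ⟨y, hy, rfl⟩ := Finset.mem_image.1 hx
        exact hR σ y (J.2.1 hy), by
        rw [Finset.prod_image (fun x _ y _ h => σ.injective h)]
        simp_rw [hD]
        rw [← map_prod]
        exact J.2.2.map σ⟩
      one_smul := fun J => Subtype.ext (by
        change J.1.image (1 : L ≃ₐ[K] L) = J.1
        ext x; simp)
      mul_smul := fun σ τ J => Subtype.ext (by
        change J.1.image (σ * τ : L ≃ₐ[K] L) = (J.1.image τ).image σ
        rw [Finset.image_image]; rfl) }
  have : Fintype V := Fintype.ofFinite V
  have hp : IsPGroup 2 (L ≃ₐ[K] L) :=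
    IsPGroup.of_card (n := k) (by rw [IsGalois.card_aut_eq_finrank, hk])
  have : Fact (Nat.Prime 2) := ⟨Nat.prime_two⟩
  have heven : 2 ∣ Nat.card V := by
    let g : V → V := fun J => ⟨symmDiff J.1 J₀, by
      intro x hx
      rw [Finset.mem_symmDiff] at hx
      rcases hx with hx | hx
      · exact J.2.1 hx.1
      · exact hJR hx.1, isSquare_symmDiff D _ _ (fun a ha => h0 a (J.2.1 ha)) (J.2.2.mul hsq)⟩
    have hgg : ∀ v, g (g v) = v := fun v => Subtype.ext (by
      change symmDiff (symmDiff v.1 J₀) J₀ = v.1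
      simp)
    have hne : ∀ v, g v ≠ v := by
      intro v h
      have h' : symmDiff v.1 J₀ = v.1 := congrArg Subtype.val h
      rw [symmDiff_eq_left] at h'
      exact hJ.ne_empty h'
    rw [Nat.card_eq_fintype_card, ← Finset.card_univ]
    let g' : Function.End V := g
    have hg' : g' ^ 2 ^ 1 = 1 := by
      rw [pow_one, pow_two]
      funext v
      exact hgg v
    have h1 := Equiv.Perm.card_fixedPoints_modEq hg'
    have h2 : IsEmpty (Function.fixedPoints g) := ⟨fun v => hne v.1 v.2⟩
    rw [Finset.card_univ]
    have h3 : Fintype.card (Function.fixedPoints g) = 0 := Fintype.card_eq_zero_iff.2 h2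
    exact (Nat.modEq_zero_iff_dvd.1 (h1.trans (by
      rw [← h3])))
  let v0 : V := ⟨∅, Finset.empty_subset _, by simp⟩
  have hv0 : v0 ∈ MulAction.fixedPoints (L ≃ₐ[K] L) V := by
    intro σ; apply Subtype.ext; change Finset.image σ ∅ = ∅; simp
  obtain ⟨w, hw, hne⟩ := hp.exists_fixed_point_of_prime_dvd_card_of_fixed_point V heven hv0
  have hwne : w.1.Nonempty := by
    rw [Finset.nonempty_iff_ne_empty]
    intro h; exact hne (Subtype.ext h.symm)
  have := fixed_or R htr w.1 w.2.1 hwne (fun σ => congrArg Subtype.val (hw σ))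
  rw [← this]; exact w.2.2

theorem empty_or_all [DecidableEq L] (R : Finset L)
    (hR : ∀ σ : L ≃ₐ[K] L, ∀ α ∈ R, σ α ∈ R)
    (htr : ∀ α ∈ R, ∀ β ∈ R, ∃ σ : L ≃ₐ[K] L, σ α = β)
    (D : L → L) (hD : ∀ (σ : L ≃ₐ[K] L) x, D (σ x) = σ (D x))
    (hind : ∀ J ⊆ R, J.Nonempty → ¬ IsSquare (∏ a ∈ J, D a))
    (x : K) (hx : x ≠ 0) (J : Finset L) (hJR : J ⊆ R)
    (hsq : IsSquare (algebraMap K L x * ∏ a ∈ J, D a)) : J = ∅ ∨ J = R := by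
  rcases J.eq_empty_or_nonempty with h | hJ
  · exact Or.inl h
  right
  have h0 : ∀ a ∈ R, D a ≠ 0 := by
    intro a ha h
    refine hind {a} (by simpa using ha) (by simp) ?_
    simp [h]
  apply fixed_or R htr J hJR hJ
  intro σ
  have himg : J.image σ ⊆ R := by
    intro y hy
    obtain ⟨z, hz, rfl⟩ := Finset.mem_image.1 hy
    exact hR σ z (hJR hz)
  have hpi : ∏ a ∈ J.image σ, D a = σ (∏ a ∈ J, D a) := by
    rw [Finset.prod_image (fun x _ y _ h => σ.injective h), map_prod]
    simp_rw [hD]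
  have hs : IsSquare (∏ a ∈ symmDiff J (J.image σ), D a) := by
    apply isSquare_symmDiff D _ _ (fun a ha => h0 a (hJR ha))
    have h2 := hsq.map σ
    rw [map_mul, ← hpi, AlgEquiv.commutes] at h2
    obtain ⟨y, hy⟩ := hsq.mul h2
    have hx' : algebraMap K L x ≠ 0 := by simpa using hx
    refine ⟨y / algebraMap K L x, ?_⟩
    field_simp
    linear_combination hy
  by_contra hne
  refine hind _ ?_ ?_ hs
  · intro y hy
    rw [Finset.mem_symmDiff] at hy
    rcases hy with hy | hy
    · exact hJR hy.1
    · exact himg hy.1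
  · rw [Finset.nonempty_iff_ne_empty]
    intro h
    exact hne (symmDiff_eq_bot.1 h).symm
end partA4

theorem polyIter_succ' {R : Type*} [CommRing R] (φ : Polynomial R) (n : ℕ) :
    polyIter φ (n + 1) = (polyIter φ n).comp φ := by
  induction n with
  | zero => simp [polyIter]
  | succ n ih =>
    calc polyIter φ (n + 1 + 1) = φ.comp (polyIter φ (n + 1)) := rfl
      _ = φ.comp ((polyIter φ n).comp φ) := by rw [ih]
      _ = (φ.comp (polyIter φ n)).comp φ := by rw [Polynomial.comp_assoc]
      _ = _ := rfl

section partA5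
variable {K : Type*} [Field K]

/-- The quadratic polynomial over a general field. -/
noncomputable def quadPoly (γ c : K) : K[X] := (X - C γ) ^ 2 + C c

/-- Adjusted critical orbit. -/
noncomputable def adjOrb (γ c : K) (n : ℕ) : K :=
  (-1) ^ (2 ^ n) * (polyIter (quadPoly γ c) n).eval c

/-- A square root in an algebraically closed field. -/
noncomputable def rt {Ω : Type*} [Field Ω] [IsAlgClosed Ω] (x : Ω) : Ω :=
  Classical.choose (IsAlgClosed.exists_eq_mul_self x)

theorem rt_mul {Ω : Type*} [Field Ω] [IsAlgClosed Ω] (x : Ω) : rt x * rt x = x :=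
  (Classical.choose_spec (IsAlgClosed.exists_eq_mul_self x)).symm

open Classical in
/-- The set of roots of the `n`-th iterate. -/
noncomputable def Rn {Ω : Type*} [Field Ω] [IsAlgClosed Ω] (g c : Ω) : ℕ → Finset Ω
  | 0 => {0}
  | n + 1 => (Rn g c n).biUnion fun α => {g + rt (α - c), g - rt (α - c)}

variable {Ω : Type*} [Field Ω] [IsAlgClosed Ω] [Algebra K Ω]

theorem mem_pair_iff [DecidableEq Ω] (g c α β : Ω) :
    β ∈ ({g + rt (α - c), g - rt (α - c)} : Finset Ω) ↔ (β - g) ^ 2 + c = α := by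
  rw [Finset.mem_insert, Finset.mem_singleton]
  have h := rt_mul (α - c)
  constructor
  · rintro (rfl | rfl)
    · linear_combination h
    · linear_combination h
  · intro h'
    have : (β - (g + rt (α - c))) * (β - (g - rt (α - c))) = 0 := by
      linear_combination h' - h
    rcases mul_eq_zero.1 this with h | h
    · left; exact sub_eq_zero.1 h
    · right; exact sub_eq_zero.1 h

theorem mem_Rn_succ (g c β : Ω) (n : ℕ) :
    β ∈ Rn g c (n + 1) ↔ (β - g) ^ 2 + c ∈ Rn g c n := by
  classical
  rw [Rn, Finset.mem_biUnion]
  constructor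
  · rintro ⟨α, hα, h⟩
    have h := (mem_pair_iff g c α β).1 (by convert h)
    rwa [h]
  · intro h
    refine ⟨_, h, ?_⟩
    have := (mem_pair_iff g c ((β - g) ^ 2 + c) β).2 rfl
    convert this

theorem aeval_quadPoly (γ c : K) (x : Ω) :
    aeval x (quadPoly γ c) = (x - algebraMap K Ω γ) ^ 2 + algebraMap K Ω c := by
  simp [quadPoly]

theorem mem_Rn_iff (γ c : K) (n : ℕ) (β : Ω) :
    β ∈ Rn (algebraMap K Ω γ) (algebraMap K Ω c) n ↔ aeval β (polyIter (quadPoly γ c) n) = 0 := by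
  induction n generalizing β with
  | zero => simp [Rn, polyIter]
  | succ n ih =>
    rw [mem_Rn_succ, ih, polyIter_succ', aeval_comp, aeval_quadPoly]

theorem quadPoly_monic (γ c : K) : (quadPoly γ c).Monic := by
  unfold quadPoly
  monicity!

theorem quadPoly_natDegree (γ c : K) : (quadPoly γ c).natDegree = 2 := by
  unfold quadPoly
  compute_degree!

theorem polyIter_monic (γ c : K) (n : ℕ) : (polyIter (quadPoly γ c) n).Monic := by
  induction n with
  | zero => exact monic_X
  | succ n ih =>
    rw [polyIter_succ']
    exact ih.comp (quadPoly_monic γ c) (by rw [quadPoly_natDegree]; norm_num)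

variable (Ω) in
/-- The splitting field of the `n`-th iterate inside `Ω`. -/
noncomputable def Kn (γ c : K) (n : ℕ) : IntermediateField K Ω :=
  IntermediateField.adjoin K (Rn (algebraMap K Ω γ) (algebraMap K Ω c) n : Set Ω)

theorem coe_Rn (γ c : K) (n : ℕ) :
    (Rn (algebraMap K Ω γ) (algebraMap K Ω c) n : Set Ω) =
      (polyIter (quadPoly γ c) n).rootSet Ω := by
  ext x
  rw [Polynomial.mem_rootSet_of_ne (polyIter_monic γ c n).ne_zero, Finset.mem_coe, mem_Rn_iff]

theorem Kn_isSplittingField (γ c : K) (n : ℕ) :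
    IsSplittingField K (Kn Ω γ c n) (polyIter (quadPoly γ c) n) := by
  unfold Kn
  rw [coe_Rn]
  exact IntermediateField.adjoin_rootSet_isSplittingField (IsAlgClosed.splits _)

theorem Kn_succ (γ c : K) (n : ℕ) :
    Kn Ω γ c (n + 1) = Kn Ω γ c n ⊔ IntermediateField.adjoin K
      ((fun α => rt (α - algebraMap K Ω c)) '' (Rn (algebraMap K Ω γ) (algebraMap K Ω c) n)) := by
  classical
  have hsub : ∀ α ∈ Rn (algebraMap K Ω γ) (algebraMap K Ω c) n,
      rt (α - algebraMap K Ω c) ∈ Kn Ω γ c (n + 1) := by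
    intro α hα
    have h1 : algebraMap K Ω γ + rt (α - algebraMap K Ω c) ∈ Kn Ω γ c (n + 1) := by
      apply IntermediateField.subset_adjoin
      rw [Finset.mem_coe, mem_Rn_succ]
      convert hα using 1
      linear_combination rt_mul (α - algebraMap K Ω c)
    have h2 := (Kn Ω γ c (n + 1)).sub_mem h1 ((Kn Ω γ c (n + 1)).algebraMap_mem γ)
    simpa using h2
  apply le_antisymm
  · rw [Kn, IntermediateField.adjoin_le_iff]
    intro β hβ
    rw [Finset.mem_coe, Rn, Finset.mem_biUnion] at hβ
    obtain ⟨α, hα, hβ⟩ := hβ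
    have h1 : rt (α - algebraMap K Ω c) ∈ Kn Ω γ c n ⊔ IntermediateField.adjoin K
      ((fun α => rt (α - algebraMap K Ω c)) '' (Rn (algebraMap K Ω γ) (algebraMap K Ω c) n)) :=
      (le_sup_right : _ ≤ Kn Ω γ c n ⊔ _) (IntermediateField.subset_adjoin K _ ⟨α, hα, rfl⟩)
    rw [Finset.mem_insert, Finset.mem_singleton] at hβ
    rcases hβ with rfl | rfl
    · exact add_mem (IntermediateField.algebraMap_mem _ γ) h1
    · exact sub_mem (IntermediateField.algebraMap_mem _ γ) h1
  · refine sup_le ?_ ?_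
    · rw [Kn, IntermediateField.adjoin_le_iff]
      intro α hα
      have h := hsub α hα
      have : α = rt (α - algebraMap K Ω c) * rt (α - algebraMap K Ω c) + algebraMap K Ω c := by
        rw [rt_mul]; ring
      rw [this]
      exact add_mem (mul_mem h h) (IntermediateField.algebraMap_mem _ c)
    · rw [IntermediateField.adjoin_le_iff]
      rintro _ ⟨α, hα, rfl⟩
      exact hsub α hα

theorem Rn_pairwiseDisjoint [DecidableEq Ω] (g c : Ω) (s : Set Ω) :
    s.PairwiseDisjoint (fun α => ({g + rt (α - c), g - rt (α - c)} : Finset Ω)) := by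
  intro α _ α' _ hne
  rw [Function.onFun, Finset.disjoint_left]
  intro β h h'
  exact hne (((mem_pair_iff g c α β).1 h).symm.trans ((mem_pair_iff g c α' β).1 h'))

variable (Ω) in
/-- Inductive package. -/
structure Pack (γ c : K) (n : ℕ) : Prop where
  fr : Module.finrank K (Kn Ω γ c n) = 2 ^ (2 ^ n - 1)
  card : (Rn (algebraMap K Ω γ) (algebraMap K Ω c) n).card = 2 ^ n
  prod : ∀ x : Ω, aeval x (polyIter (quadPoly γ c) n) =
    ∏ α ∈ Rn (algebraMap K Ω γ) (algebraMap K Ω c) n, (x - α)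
  tr : ∀ α ∈ Rn (algebraMap K Ω γ) (algebraMap K Ω c) n,
    ∀ β ∈ Rn (algebraMap K Ω γ) (algebraMap K Ω c) n, ∃ σ : Ω ≃ₐ[K] Ω, σ α = β
  sq : ∀ x : K, x ≠ 0 → (∃ y ∈ Kn Ω γ c n, y * y = algebraMap K Ω x) →
    ∃ S ⊆ Finset.range n, IsSquare (x * ∏ i ∈ S, adjOrb γ c i)

theorem pack_zero (γ c : K) : Pack Ω γ c 0 := by
  have h0 : Kn Ω γ c 0 = ⊥ := by
    rw [Kn, Rn]
    rw [IntermediateField.adjoin_eq_bot_iff]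
    simp
  refine ⟨?_, by simp [Rn], by simp [Rn, polyIter], ?_, ?_⟩
  · rw [h0]; simp
  · intro α hα β hβ
    refine ⟨AlgEquiv.refl, ?_⟩
    simp [Rn] at hα hβ
    simp [hα, hβ]
  · rintro x - ⟨y, hy, h⟩
    rw [h0, IntermediateField.mem_bot] at hy
    obtain ⟨z, rfl⟩ := hy
    rw [← map_mul] at h
    refine ⟨∅, by simp, z, ?_⟩
    rw [Finset.prod_empty, mul_one]
    exact ((algebraMap K Ω).injective h).symm

theorem pack_succ [CharZero K] [CharZero Ω] [IsGalois K Ω] (γ c : K) (n : ℕ)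
    (h : ∀ S ⊆ Finset.range n, ¬ IsSquare (adjOrb γ c n * ∏ i ∈ S, adjOrb γ c i))
    (P : Pack Ω γ c n) : Pack Ω γ c (n + 1) := by
  classical
  set g' := algebraMap K Ω γ with hg'
  set c' := algebraMap K Ω c with hc'
  set F := Kn Ω γ c n with hF
  set R := Rn g' c' n with hRdef
  have hRF : ∀ x ∈ R, x ∈ F := fun x hx => IntermediateField.subset_adjoin K _ hx
  have hspl := Kn_isSplittingField (Ω := Ω) γ c n
  have hfd : FiniteDimensional K F := by
    apply FiniteDimensional.of_finrank_pos
    rw [P.fr]; positivity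
  have hnorm : Normal K F := Normal.of_isSplittingField (polyIter (quadPoly γ c) n)
  have hgal : IsGalois K F := ⟨⟩
  set R' : Finset F := R.subtype (· ∈ F) with hR'
  let D : F → F := fun a => a - algebraMap K F c
  have hD : ∀ (σ : F ≃ₐ[K] F) x, D (σ x) = σ (D x) := by
    intro σ x; simp [D]
  have hR : ∀ σ : F ≃ₐ[K] F, ∀ α ∈ R', σ α ∈ R' := by
    intro σ α hα
    rw [hR', Finset.mem_subtype] at hα ⊢
    rw [hRdef, mem_Rn_iff] at hα ⊢
    have h1 : ((σ α : F) : Ω) = (F.val.comp (σ : F →ₐ[K] F)) α := rfl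
    have h2 : ((α : F) : Ω) = F.val α := rfl
    rw [h2, aeval_algHom_apply] at hα
    have hα := (map_eq_zero F.val).1 hα
    rw [h1, aeval_algHom_apply, hα, map_zero]
  have htr : ∀ α ∈ R', ∀ β ∈ R', ∃ σ : F ≃ₐ[K] F, σ α = β := by
    intro α hα β hβ
    rw [hR', Finset.mem_subtype] at hα hβ
    obtain ⟨σ, hσ⟩ := P.tr α hα β hβ
    refine ⟨σ.restrictNormal F, Subtype.ext ?_⟩
    have := AlgEquiv.restrictNormal_commutes σ F α
    exact this.trans hσ
  have hprod : ∀ S ⊆ R, ((∏ a ∈ S.subtype (· ∈ F), D a : F) : Ω) = ∏ a ∈ S, (a - c') := by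
    intro S hS
    have h1 : ((∏ a ∈ S.subtype (· ∈ F), D a : F) : Ω)
        = ∏ a ∈ S.subtype (· ∈ F), ((a : Ω) - c') := by
      have : ∀ s : Finset F, ((∏ a ∈ s, D a : F) : Ω) = ∏ a ∈ s, ((D a : F) : Ω) :=
        fun s => map_prod F.val D s
      rw [this]
      rfl
    rw [h1]
    exact Finset.prod_subtype_of_mem (fun a : Ω => a - c') (fun x hx => hRF x (hS hx))
  have hall : ∏ a ∈ R, (a - c') = algebraMap K Ω (adjOrb γ c n) := by
    have h1 := P.prod c'
    rw [hc', aeval_algebraMap_apply] at h1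
    rw [adjOrb, map_mul, map_pow, map_neg, map_one]
    rw [← Polynomial.coe_aeval_eq_eval, h1, ← P.card, ← Finset.prod_const, ← Finset.prod_mul_distrib]
    apply Finset.prod_congr rfl
    intro x _; ring
  have hane : adjOrb γ c n ≠ 0 := by
    intro h0
    apply h ∅ (Finset.empty_subset _)
    rw [h0, zero_mul]; exact IsSquare.zero
  have hind : ∀ J ⊆ R', J.Nonempty → ¬ IsSquare (∏ a ∈ J, D a) := by
    intro J hJ hJn hsq
    have h1 := exists_fixed (2 ^ n - 1) P.fr R' hR htr D hD J hJ hJn hsq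
    obtain ⟨y, hy⟩ := h1
    have h2 := hprod R le_rfl
    rw [← hR', hy, hall] at h2
    obtain ⟨S, hS, hs⟩ := P.sq _ hane ⟨y, y.2, h2⟩
    exact h S hS hs
  set e : Ω → Ω := fun α => rt (α - c') with he
  have hee : ∀ α, e α * e α = α - c' := fun α => rt_mul _
  have heF : ∀ α ∈ R, e α * e α ∈ F := by
    intro α hα
    rw [hee]
    exact sub_mem (hRF α hα) (IntermediateField.algebraMap_mem _ c)
  have hind' : ∀ S ⊆ R, S.Nonempty → ¬ ∃ z ∈ F, z * z = ∏ i ∈ S, e i * e i := by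
    rintro S hS ⟨s, hs⟩ ⟨z, hz, hzz⟩
    simp_rw [hee] at hzz
    refine hind (S.subtype (· ∈ F)) ?_ ⟨⟨s, hRF s (hS hs)⟩, ?_⟩ ⟨⟨z, hz⟩, ?_⟩
    · intro x hx
      rw [Finset.mem_subtype] at hx ⊢
      exact hS hx
    · rw [Finset.mem_subtype]; exact hs
    · apply Subtype.ext
      rw [hprod S hS, ← hzz]; rfl
  have hKs : Kn Ω γ c (n + 1) = F ⊔ IntermediateField.adjoin K (e '' R) := Kn_succ γ c n
  have heNF : ∀ α ∈ R, e α ∉ F := by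
    intro α hα hmem
    exact hind' {α} (by simpa using hα) (by simp) ⟨e α, hmem, by simp⟩
  have hpair : ∀ α ∈ R, g' + e α ≠ g' - e α := by
    intro α hα heq
    have h2 : (2 : Ω) * e α = 0 := by linear_combination heq
    have : e α = 0 := by simpa using h2
    exact heNF α hα (by rw [this]; exact F.zero_mem)
  have hRs : Rn g' c' (n + 1) = R.biUnion (fun α => ({g' + e α, g' - e α} : Finset Ω)) := by
    rw [Rn]
  have hdis := Rn_pairwiseDisjoint g' c' (R : Set Ω)
  refine ⟨?_, ?_, ?_, ?_, ?_⟩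
  · rw [hKs, kummer_finrank F e R heF hind', P.fr, P.card, ← pow_add]
    congr 1
    have : 1 ≤ 2 ^ n := Nat.one_le_two_pow
    rw [pow_succ]; omega
  · rw [hRs, Finset.card_biUnion hdis, Finset.sum_congr rfl (fun α hα => Finset.card_pair (hpair α hα)),
      Finset.sum_const, P.card, pow_succ]
    rfl
  · intro x
    rw [hRs, Finset.prod_biUnion hdis, polyIter_succ', aeval_comp, aeval_quadPoly, P.prod]
    apply Finset.prod_congr rfl
    intro α hα
    rw [Finset.prod_pair (hpair α hα)]
    linear_combination hee α
  · intro β hβ β' hβ'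
    rw [mem_Rn_succ] at hβ hβ'
    obtain ⟨σ, hσ⟩ := P.tr _ hβ _ hβ'
    set α' := (β' - g') ^ 2 + c' with hα'
    have h1 : (σ β - g') ^ 2 + c' = α' := by
      rw [← hσ]; simp [g', c']
    have h2 : (σ β - β') * (σ β - (2 * g' - β')) = 0 := by
      linear_combination h1 - hα'
    rcases mul_eq_zero.1 h2 with h3 | h3
    · exact ⟨σ, sub_eq_zero.1 h3⟩
    have hβF : β' ∉ F := by
      intro hmem
      have h4 : (β' - g' - e α') * (β' - g' + e α') = 0 := by
        linear_combination -hα' - hee α'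
      have h5 : β' - g' ∈ F := sub_mem hmem (IntermediateField.algebraMap_mem _ γ)
      rcases mul_eq_zero.1 h4 with h6 | h6
      · exact heNF α' hβ' (by rw [← sub_eq_zero.1 h6]; exact h5)
      · apply heNF α' hβ'
        have : e α' = -(β' - g') := by linear_combination h6
        rw [this]; exact neg_mem h5
    have h7 : ∃ τ ∈ F.fixingSubgroup, τ β' ≠ β' := by
      by_contra hcon
      push Not at hcon
      apply hβF
      rw [← InfiniteGalois.fixedField_fixingSubgroup F, IntermediateField.mem_fixedField_iff]
      exact hcon
    obtain ⟨τ, hτF, hτ⟩ := h7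
    have h8 : τ α' = α' := by
      rw [IntermediateField.mem_fixingSubgroup_iff] at hτF
      exact hτF α' (hRF _ hβ')
    have h9 : (τ β' - g') ^ 2 + c' = α' := by
      rw [← h8, hα']; simp [g', c']
    have h10 : (τ β' - β') * (τ β' - (2 * g' - β')) = 0 := by
      linear_combination h9 - hα'
    have h11 : τ β' = 2 * g' - β' := by
      rcases mul_eq_zero.1 h10 with h12 | h12
      · exact absurd (sub_eq_zero.1 h12) hτ
      · exact sub_eq_zero.1 h12
    refine ⟨σ.trans τ, ?_⟩
    rw [AlgEquiv.trans_apply, sub_eq_zero.1 h3, map_sub, map_mul, h11, map_ofNat,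
      show τ g' = g' from τ.commutes γ]
    ring
  · rintro x hx ⟨y, hy, hyx⟩
    rw [hKs] at hy
    obtain ⟨S, hS, z, hz, hzz⟩ := kummer_sq F e R heF _ (F.algebraMap_mem x) y hy hyx
    simp_rw [hee] at hzz
    have h1 : IsSquare (algebraMap K F x * ∏ a ∈ S.subtype (· ∈ F), D a) := by
      refine ⟨⟨z, hz⟩, Subtype.ext ?_⟩
      have := hprod S hS
      change (algebraMap K Ω x) * ((∏ a ∈ S.subtype (· ∈ F), D a : F) : Ω) = z * z
      rw [this, hzz]
    have hSR : S.subtype (· ∈ F) ⊆ R' := by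
      intro a ha
      rw [Finset.mem_subtype] at ha ⊢
      exact hS ha
    rcases empty_or_all R' hR htr D hD hind x hx _ hSR h1 with h2 | h2
    · have h3 := hprod S hS
      rw [h2, Finset.prod_empty] at h3
      rw [← h3] at hzz
      obtain ⟨S', hS', hs⟩ := P.sq x hx ⟨z, hz, by simpa using hzz⟩
      exact ⟨S', hS'.trans (Finset.range_mono (Nat.le_succ n)), hs⟩
    · have h3 := hprod S hS
      rw [h2, hR', hprod R le_rfl, hall] at h3
      rw [← h3, ← map_mul] at hzz
      obtain ⟨S', hS', hs⟩ := P.sq _ (mul_ne_zero hx hane) ⟨z, hz, hzz⟩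
      have hn : n ∉ S' := fun hn => by simpa using hS' hn
      refine ⟨insert n S', ?_, ?_⟩
      · intro i hi
        rw [Finset.mem_insert] at hi
        rcases hi with rfl | hi
        · simp
        · have := hS' hi
          simp at this ⊢; omega
      · rw [Finset.prod_insert hn, ← mul_assoc]; exact hs

theorem galois_main [CharZero K] (γ c : K)
    (h : ∀ n, ∀ S ⊆ Finset.range n, ¬ IsSquare (adjOrb γ c n * ∏ i ∈ S, adjOrb γ c i)) (n : ℕ) :
    Module.finrank K (polyIter (quadPoly γ c) n).SplittingField = 2 ^ (2 ^ n - 1) := by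
  have hcz : CharZero (AlgebraicClosure K) := algebraRat.charZero _
  have hP : Pack (AlgebraicClosure K) γ c n := by
    induction n with
    | zero => exact pack_zero γ c
    | succ n ih => exact pack_succ γ c n (h n) ih
  rw [← hP.fr]
  have := Kn_isSplittingField (Ω := AlgebraicClosure K) γ c n
  exact (IsSplittingField.algEquiv (Kn (AlgebraicClosure K) γ c n)
    (polyIter (quadPoly γ c) n)).toLinearEquiv.finrank_eq.symm

end partA5

section partB

/-- Critical orbit. -/
def orb {A : Type*} [CommRing A] (g c : A) : ℕ → A
  | 0 => c
  | n + 1 => (orb g c n - g) ^ 2 + c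

theorem map_orb {A B : Type*} [CommRing A] [CommRing B] (f : A →+* B) (g c : A) (n : ℕ) :
    f (orb g c n) = orb (f g) (f c) n := by
  induction n with
  | zero => rfl
  | succ n ih => simp [orb, ih]

theorem adjOrb_eq {K : Type*} [Field K] (γ c : K) (n : ℕ) :
    adjOrb γ c n = (-1) ^ (2 ^ n) * orb γ c n := by
  unfold adjOrb
  congr 1
  induction n with
  | zero => simp [polyIter, orb]
  | succ n ih =>
    rw [polyIter, eval_comp, ih]
    simp [quadPoly, orb]

theorem orb_escape (g c : ℂ) (m : ℕ) (h2 : 2 < ‖orb g c m - g‖) (hd : ‖c - g‖ ≤ ‖orb g c m - g‖) :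
    ‖orb g c m - g‖ < ‖orb g c (m + 1) - g‖ := by
  have h : orb g c (m + 1) - g = (orb g c m - g) ^ 2 - (-(c - g)) := by
    simp only [orb]; ring
  rw [h]
  have h3 := norm_sub_norm_le ((orb g c m - g) ^ 2) (-(c - g))
  rw [norm_pow, norm_neg] at h3
  nlinarith

theorem orb_escape' (g c : ℂ) (m : ℕ) (h2 : 2 < ‖orb g c m - g‖)
    (hd : ‖c - g‖ ≤ ‖orb g c m - g‖) (k : ℕ) :
    ‖orb g c m - g‖ ≤ ‖orb g c (m + k) - g‖ := by
  induction k with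
  | zero => exact le_rfl
  | succ k ih =>
    exact ih.trans (orb_escape g c (m + k) (h2.trans_le ih) (hd.trans ih)).le

theorem orb_escape'' (g c : ℂ) (m : ℕ) (h2 : 2 < ‖orb g c m - g‖)
    (hd : ‖c - g‖ ≤ ‖orb g c m - g‖) (i n : ℕ) (hmi : m ≤ i) (hin : i < n) :
    ‖orb g c i - g‖ < ‖orb g c n - g‖ := by
  obtain ⟨k, rfl⟩ := Nat.exists_eq_add_of_le hmi
  have h1 := orb_escape' g c m h2 hd k
  have h3 := orb_escape g c (m + k) (h2.trans_le h1) (hd.trans h1)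
  obtain ⟨l, rfl⟩ := Nat.exists_eq_add_of_lt hin
  have h4 := orb_escape' g c (m + k + 1) ((h2.trans_le h1).trans h3) ((hd.trans h1).trans h3.le) l
  rw [show m + k + l + 1 = m + k + 1 + l by ring]
  exact h3.trans_le h4

theorem orb_bound (g c : ℂ) (i n : ℕ) (hin : i < n) (hi : orb g c i = 0) (hn : orb g c n = 0) :
    ‖g‖ ≤ 2 ∧ ‖c‖ ≤ 4 := by
  have hd : ‖c - g‖ ≤ 2 := by
    by_contra h
    push Not at h
    have := orb_escape'' g c 0 h le_rfl i n (Nat.zero_le _) hin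
    rw [hi, hn] at this
    exact lt_irrefl _ this
  have hg : ‖g‖ ≤ 2 := by
    by_contra h
    push Not at h
    have h' : 2 < ‖orb g c i - g‖ := by rwa [hi, zero_sub, norm_neg]
    have := orb_escape'' g c i h' (hd.trans h'.le) i n le_rfl hin
    rw [hi, hn] at this
    exact lt_irrefl _ this
  refine ⟨hg, ?_⟩
  have : c = (c - g) + g := by ring
  rw [this]
  exact (norm_add_le _ _).trans (by linarith)

theorem natDegree_orb (d : ℕ) (hd : 1 ≤ d) (g c : ℂ[X]) (hδ : (c - g).natDegree = d) (m : ℕ) :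
    (orb g c m - g).natDegree = 2 ^ m * d := by
  induction m with
  | zero => simpa [orb] using hδ
  | succ m ih =>
    have h : orb g c (m + 1) - g = (orb g c m - g) ^ 2 + (c - g) := by simp only [orb]; ring
    have h1 : 1 ≤ 2 ^ m := Nat.one_le_two_pow
    rw [h, natDegree_add_eq_left_of_natDegree_lt]
    · rw [natDegree_pow, ih, pow_succ]; ring
    · rw [natDegree_pow, ih, hδ]; nlinarith

theorem quad_rel (d : ℕ) (hd : 1 ≤ d) (c δ : ℂ[X]) (u : ℂ) (h : c = C u * (C u + 2 * δ)) :
    4 * δ.coeff d ^ 2 * c.coeff 0 = c.coeff d ^ 2 + 4 * c.coeff d * δ.coeff d * δ.coeff 0 := by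
  have hd' : d ≠ 0 := by omega
  have h2 : (2 : ℂ[X]) * δ = C 2 * δ := by rw [map_ofNat]
  have h3 : c.coeff d = u * (2 * δ.coeff d) := by
    rw [h, h2, coeff_C_mul, coeff_add, coeff_C_mul, coeff_C_of_ne_zero hd', zero_add]
  have h4 : c.coeff 0 = u * (u + 2 * δ.coeff 0) := by
    rw [h, h2, coeff_C_mul, coeff_add, coeff_C_mul, coeff_C_zero]
  rw [h3, h4]; ring

theorem orb_not_sq (d : ℕ) (hd : 1 ≤ d) (g c : ℂ[X]) (hδ : (c - g).natDegree = d)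
    (hc : c.natDegree = d)
    (hP : 4 * (c - g).coeff d ^ 2 * c.coeff 0 ≠
      c.coeff d ^ 2 + 4 * c.coeff d * (c - g).coeff d * (c - g).coeff 0) (m : ℕ) (s : ℂ[X]) :
    orb g c (m + 1) ≠ s * s := by
  intro hs
  have hA := natDegree_orb d hd g c hδ m
  have hA0 : orb g c 0 - g = c - g := rfl
  set A := orb g c m - g with hAdef
  have hfh : (s - A) * (s + A) = c := by
    rw [orb] at hs
    linear_combination -hs
  have hc0 : c ≠ 0 := by intro h; rw [h, natDegree_zero] at hc; omega
  have hf0 : s - A ≠ 0 := by intro h; rw [h, zero_mul] at hfh; exact hc0 hfh.symm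
  have hh0 : s + A ≠ 0 := by intro h; rw [h, mul_zero] at hfh; exact hc0 hfh.symm
  have hdeg : (s - A).natDegree + (s + A).natDegree = d := by
    rw [← natDegree_mul hf0 hh0, hfh, hc]
  have h2A : (s + A) - (s - A) = C 2 * A := by
    have : (C 2 : ℂ[X]) = 2 := map_ofNat C 2
    rw [this]; ring
  have hle := natDegree_sub_le (s + A) (s - A)
  rw [h2A, natDegree_C_mul (two_ne_zero), hA] at hle
  have h1 : 1 ≤ 2 ^ m := Nat.one_le_two_pow
  have hmax : d ≤ max (s + A).natDegree (s - A).natDegree := le_trans (by nlinarith) hle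
  have hm : m = 0 := by
    by_contra hm
    have : 2 ≤ 2 ^ m := by
      calc 2 = 2 ^ 1 := rfl
        _ ≤ 2 ^ m := Nat.pow_le_pow_right (by norm_num) (by omega)
    have h3 : max (s + A).natDegree (s - A).natDegree ≤ d := max_le (by omega) (by omega)
    nlinarith
  subst hm
  have hAd : A = c - g := hA0
  apply hP
  rcases le_max_iff.1 hmax with h | h
  · have h0 : (s - A).natDegree = 0 := by omega
    obtain ⟨u, hu⟩ := natDegree_eq_zero.1 h0
    apply quad_rel d hd c _ u
    rw [← hAd]
    have h5 : s = C u + A := by rw [hu]; ring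
    rw [← hfh, h5]; ring
  · have h0 : (s + A).natDegree = 0 := by omega
    obtain ⟨u, hu⟩ := natDegree_eq_zero.1 h0
    apply quad_rel d hd c _ (-u)
    rw [← hAd]
    have h5 : s = C u - A := by rw [hu]; ring
    rw [← hfh, h5]; simp only [map_neg]; ring

theorem isSquare_of_coprime (a b s : ℂ[X]) (hab : IsCoprime a b) (h : a * b = s * s) :
    ∃ r, a = r * r := by
  obtain ⟨r, u, hu⟩ := exists_associated_pow_of_mul_eq_pow' hab (h.trans (pow_two s).symm)
  obtain ⟨v, hv, hvu⟩ := Polynomial.isUnit_iff.1 u.isUnit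
  obtain ⟨w, hw⟩ := IsAlgClosed.exists_eq_mul_self v
  refine ⟨r * C w, ?_⟩
  rw [← hu, ← hvu, hw, map_mul]; ring

theorem isSquare_of_ratFunc (p : ℚ[X]) (h : IsSquare (algebraMap ℚ[X] (RatFunc ℚ) p)) :
    IsSquare p := by
  obtain ⟨y, hy⟩ := h
  obtain ⟨z, hz⟩ := IsIntegrallyClosed.exists_algebraMap_eq_of_isIntegral_pow
    (R := ℚ[X]) (K := RatFunc ℚ) (x := y) (n := 2) (by norm_num)
    (by rw [pow_two, ← hy]; exact isIntegral_algebraMap)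
  refine ⟨z, ?_⟩
  rw [← hz, ← map_mul] at hy
  exact IsFractionRing.injective ℚ[X] (RatFunc ℚ) hy

theorem surj_of_conditions (d : ℕ) (hd : 1 ≤ d) (γ c : ℤ[X]) (hγd : γ.natDegree ≤ d)
    (hcd : c.natDegree ≤ d) (h1 : c.coeff d ≠ 0) (h2 : c.coeff d ≠ γ.coeff d)
    (h3 : 4 * (c.coeff d - γ.coeff d) ^ 2 * c.coeff 0 ≠
      c.coeff d ^ 2 + 4 * c.coeff d * (c.coeff d - γ.coeff d) * (c.coeff 0 - γ.coeff 0))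
    (h4 : ¬ IsSquare (-(c.coeff 0)))
    (h5 : ∀ t : ℂ, ¬ (‖(γ.map (Int.castRingHom ℂ)).eval t‖ ≤ 2 ∧
      ‖(c.map (Int.castRingHom ℂ)).eval t‖ ≤ 4)) : IsSurjPair γ c := by
  intro n hn1
  have hphi : phiPair γ c = quadPoly (algebraMap (Polynomial ℚ) (RatFunc ℚ) (γ.map (Int.castRingHom ℚ)))
    (algebraMap (Polynomial ℚ) (RatFunc ℚ) (c.map (Int.castRingHom ℚ))) := rfl
  rw [hphi]
  apply galois_main
  clear hn1 n
  intro n S hS hsq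
  simp_rw [adjOrb_eq, ← map_orb] at hsq
  have hsq1 : IsSquare ((-1) ^ (2 ^ n) * orb (γ.map (Int.castRingHom ℚ)) (c.map (Int.castRingHom ℚ)) n
      * ∏ i ∈ S, ((-1) ^ (2 ^ i) *
        orb (γ.map (Int.castRingHom ℚ)) (c.map (Int.castRingHom ℚ)) i)) := by
    apply isSquare_of_ratFunc
    simpa [map_prod] using hsq
  rcases Nat.eq_zero_or_pos n with hn | hn
  · subst hn
    have hS0 : S = ∅ := by simpa using hS
    subst hS0
    have h6 := hsq1.map (evalRingHom (0 : ℚ))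
    simp only [pow_zero, pow_one, orb, Finset.prod_empty, mul_one, neg_mul, one_mul, coe_evalRingHom,
      eval_neg] at h6
    rw [← coeff_zero_eq_eval_zero, coeff_map] at h6
    apply h4
    rw [← Rat.isSquare_intCast_iff]
    simpa using h6
  obtain ⟨m, rfl⟩ : ∃ m, n = m + 1 := ⟨n - 1, by omega⟩
  set g' := γ.map (Int.castRingHom ℂ) with hg'
  set c' := c.map (Int.castRingHom ℂ) with hc'
  have hmap : ∀ i, (mapRingHom (algebraMap ℚ ℂ)) (orb (γ.map (Int.castRingHom ℚ)) (c.map (Int.castRingHom ℚ)) i)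
      = orb g' c' i := by
    intro i
    rw [map_orb]
    simp only [coe_mapRingHom, Polynomial.map_map, hg', hc']
    congr 2
  obtain ⟨s, hs⟩ := hsq1.map (mapRingHom (algebraMap ℚ ℂ))
  simp only [map_mul, map_prod, hmap, map_pow, map_neg, map_one] at hs
  rw [Finset.prod_mul_distrib] at hs
  have hcop : ∀ i < m + 1, IsCoprime (orb g' c' (m + 1)) (orb g' c' i) := by
    intro i hi
    rw [Polynomial.isCoprime_iff_aeval_ne_zero_of_isAlgClosed ℂ ℂ]
    intro t
    by_contra hcon
    push Not at hcon
    have e1 : ∀ j, aeval t (orb g' c' j) = orb (g'.eval t) (c'.eval t) j := by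
      intro j
      have := map_orb (evalRingHom t) g' c' j
      simpa using this
    rw [e1, e1] at hcon
    exact h5 t (orb_bound _ _ i (m + 1) hi hcon.2 hcon.1)
  have hunit : IsUnit ((-1 : ℂ[X]) ^ (2 ^ (m + 1)) * ∏ i ∈ S, (-1 : ℂ[X]) ^ (2 ^ i)) := by
    apply IsUnit.mul
    · exact (isUnit_one.neg).pow _
    · rw [Finset.prod_pow_eq_pow_sum]
      exact (isUnit_one.neg).pow _
  have hcop2 : IsCoprime (orb g' c' (m + 1))
      (((-1 : ℂ[X]) ^ (2 ^ (m + 1)) * ∏ i ∈ S, (-1 : ℂ[X]) ^ (2 ^ i)) * ∏ i ∈ S, orb g' c' i) := by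
    rw [isCoprime_mul_unit_left_right hunit]
    apply IsCoprime.prod_right
    intro i hi
    exact hcop i (by simpa using hS hi)
  obtain ⟨r, hr⟩ := isSquare_of_coprime _ _ s hcop2 (by rw [← hs]; ring)
  have hcc : ∀ i, c'.coeff i = (c.coeff i : ℂ) := fun i => by simp [hc']
  have hgc : ∀ i, g'.coeff i = (γ.coeff i : ℂ) := fun i => by simp [hg']
  refine orb_not_sq d hd g' c' ?_ ?_ ?_ m r hr
  · apply natDegree_eq_of_le_of_coeff_ne_zero
    · exact (natDegree_sub_le _ _).trans
        (max_le ((natDegree_map_le).trans hcd) ((natDegree_map_le).trans hγd))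
    · rw [coeff_sub, hcc, hgc, sub_ne_zero]
      exact_mod_cast h2
  · apply natDegree_eq_of_le_of_coeff_ne_zero
    · exact (natDegree_map_le).trans hcd
    · rw [hcc]; exact_mod_cast h1
  · simp only [coeff_sub, hcc, hgc]
    exact_mod_cast h3

end partB

section partC

/-- The box of integer vectors. -/
noncomputable def box (ι : Type*) [Fintype ι] [DecidableEq ι] (B : ℕ) : Finset (ι → ℤ) :=
  Fintype.piFinset (fun _ => Finset.Icc (-(B : ℤ)) B)

theorem card_box (ι : Type*) [Fintype ι] [DecidableEq ι] (B : ℕ) :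
    (box ι B).card = (2 * B + 1) ^ Fintype.card ι := by
  have : (Finset.Icc (-(B : ℤ)) B).card = 2 * B + 1 := by
    rw [Int.card_Icc]; omega
  simp [box, this]

theorem mem_box {ι : Type*} [Fintype ι] [DecidableEq ι] {B : ℕ} {f : ι → ℤ} :
    f ∈ box ι B ↔ ∀ i, f i ∈ Finset.Icc (-(B : ℤ)) B := by
  simp [box]

theorem card_Icc_B (B : ℕ) : (Finset.Icc (-(B : ℤ)) B).card = 2 * B + 1 := by
  rw [Int.card_Icc]; omega

theorem fiber_one {ι : Type*} [Fintype ι] [DecidableEq ι] (B : ℕ) (s : Finset (ι → ℤ))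
    (hs : s ⊆ box ι B) (i₀ : ι) (M : ℕ)
    (h : ∀ g : ι → ℤ, ((Finset.Icc (-(B : ℤ)) B).filter
      (fun v => Function.update g i₀ v ∈ s)).card ≤ M) :
    s.card ≤ M * (2 * B + 1) ^ (Fintype.card ι - 1) := by
  classical
  let t : Finset (ι → ℤ) := Fintype.piFinset
    (fun j => if j = i₀ then ({0} : Finset ℤ) else Finset.Icc (-(B : ℤ)) B)
  have ht : t.card = (2 * B + 1) ^ (Fintype.card ι - 1) := by
    rw [Fintype.card_piFinset, ← Finset.mul_prod_erase Finset.univ _ (Finset.mem_univ i₀)]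
    rw [Finset.prod_congr rfl (g := fun _ => 2 * B + 1)]
    · simp [Finset.card_erase_of_mem]
    · intro x hx
      rw [if_neg (Finset.ne_of_mem_erase hx), card_Icc_B]
  rw [← ht]
  apply Finset.card_le_mul_card_image_of_maps_to (f := fun f => Function.update f i₀ 0)
  · intro f hf
    rw [Fintype.mem_piFinset]
    intro j
    by_cases hj : j = i₀
    · subst hj; simp
    · rw [if_neg hj, Function.update_of_ne hj]
      exact mem_box.1 (hs hf) j
  · intro g _
    refine le_trans ?_ (h g)
    apply Finset.card_le_card_of_injOn (fun f => f i₀)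
    · intro f hf
      rw [Finset.mem_coe, Finset.mem_filter] at hf
      obtain ⟨hf, rfl⟩ := hf
      rw [Finset.mem_coe, Finset.mem_filter]
      refine ⟨mem_box.1 (hs hf) _, ?_⟩
      simpa using hf
    · intro f hf f' hf' he
      rw [Finset.mem_coe, Finset.mem_filter] at hf hf'
      funext j
      by_cases hj : j = i₀
      · subst hj; exact he
      · have := congrFun (hf.2.trans hf'.2.symm) j
        simpa [Function.update_of_ne hj] using this

theorem fiber_two {ι : Type*} [Fintype ι] [DecidableEq ι] (B : ℕ) (s : Finset (ι → ℤ))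
    (hs : s ⊆ box ι B) (i₀ i₁ : ι) (hne : i₁ ≠ i₀) (M : ℕ)
    (h : ∀ g : ι → ℤ, ((Finset.Icc (-(B : ℤ)) B ×ˢ Finset.Icc (-(B : ℤ)) B).filter
      (fun v => Function.update (Function.update g i₀ v.1) i₁ v.2 ∈ s)).card ≤ M) :
    s.card ≤ M * (2 * B + 1) ^ (Fintype.card ι - 2) := by
  classical
  let t : Finset (ι → ℤ) := Fintype.piFinset
    (fun j => if j = i₀ ∨ j = i₁ then ({0} : Finset ℤ) else Finset.Icc (-(B : ℤ)) B)
  have ht : t.card = (2 * B + 1) ^ (Fintype.card ι - 2) := by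
    rw [Fintype.card_piFinset, ← Finset.mul_prod_erase Finset.univ _ (Finset.mem_univ i₀),
      ← Finset.mul_prod_erase (Finset.univ.erase i₀) _
        (Finset.mem_erase.2 ⟨hne, Finset.mem_univ i₁⟩)]
    rw [Finset.prod_congr rfl (g := fun _ => 2 * B + 1)]
    · have hc : ((Finset.univ.erase i₀).erase i₁).card = Fintype.card ι - 2 := by
        rw [Finset.card_erase_of_mem (Finset.mem_erase.2 ⟨hne, Finset.mem_univ i₁⟩),
          Finset.card_erase_of_mem (Finset.mem_univ _), Finset.card_univ]
        omega
      simp [hc]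
    · intro x hx
      have h1 := Finset.ne_of_mem_erase hx
      have h2 := Finset.ne_of_mem_erase (Finset.mem_of_mem_erase hx)
      rw [if_neg (by tauto), card_Icc_B]
  rw [← ht]
  apply Finset.card_le_mul_card_image_of_maps_to
    (f := fun f => Function.update (Function.update f i₀ 0) i₁ 0)
  · intro f hf
    rw [Fintype.mem_piFinset]
    intro j
    by_cases hj1 : j = i₁
    · subst hj1; simp
    by_cases hj : j = i₀
    · subst hj; simp [Function.update_of_ne hj1]
    · rw [if_neg (by tauto), Function.update_of_ne hj1, Function.update_of_ne hj]
      exact mem_box.1 (hs hf) j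
  · intro g _
    refine le_trans ?_ (h g)
    apply Finset.card_le_card_of_injOn (fun f => (f i₀, f i₁))
    · intro f hf
      rw [Finset.mem_coe, Finset.mem_filter] at hf
      obtain ⟨hf, rfl⟩ := hf
      rw [Finset.mem_coe, Finset.mem_filter, Finset.mem_product]
      refine ⟨⟨mem_box.1 (hs hf) _, mem_box.1 (hs hf) _⟩, ?_⟩
      convert hf using 1
      funext j
      by_cases hj1 : j = i₁
      · subst hj1; simp
      by_cases hj : j = i₀
      · subst hj; simp [Function.update_of_ne hj1]
      · simp [Function.update_of_ne hj1, Function.update_of_ne hj]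
    · intro f hf f' hf' he
      rw [Finset.mem_coe, Finset.mem_filter] at hf hf'
      rw [Prod.mk.injEq] at he
      funext j
      by_cases hj1 : j = i₁
      · subst hj1; exact he.2
      by_cases hj : j = i₀
      · subst hj; exact he.1
      · have := congrFun (hf.2.trans hf'.2.symm) j
        simpa [Function.update_of_ne hj, Function.update_of_ne hj1] using this

theorem card_interval (T : Finset ℤ) (α a r : ℝ) (hr : 0 ≤ r) (hα : α ≠ 0)
    (h : ∀ v ∈ T, |α * v + a| ≤ r) : (T.card : ℝ) ≤ 2 * r / |α| + 1 := by
  have hα' : 0 < |α| := abs_pos.2 hα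
  have hsub : T ⊆ Finset.Icc ⌈-(a / α) - r / |α|⌉ ⌊-(a / α) + r / |α|⌋ := by
    intro v hv
    have h1 := h v hv
    have h2 : |(v : ℝ) + a / α| ≤ r / |α| := by
      have e : ((v : ℝ) + a / α) * α = α * v + a := by field_simp
      rw [le_div_iff₀ hα', ← abs_mul, e]
      exact h1
    rw [abs_le] at h2
    rw [Finset.mem_Icc, Int.ceil_le, Int.le_floor]
    constructor <;> linarith
  have h1 := Finset.card_le_card hsub
  rw [Int.card_Icc] at h1
  have h2 : (T.card : ℤ) ≤ max (⌊-(a / α) + r / |α|⌋ + 1 - ⌈-(a / α) - r / |α|⌉) 0 := by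
    have : (T.card : ℤ) ≤ ((⌊-(a / α) + r / |α|⌋ + 1 - ⌈-(a / α) - r / |α|⌉).toNat : ℤ) := by
      exact_mod_cast h1
    rwa [Int.toNat_eq_max] at this
  have h3 : (T.card : ℝ) ≤ max ((⌊-(a / α) + r / |α|⌋ : ℝ) + 1 - ⌈-(a / α) - r / |α|⌉) 0 := by
    exact_mod_cast h2
  have h4 := Int.floor_le (-(a / α) + r / |α|)
  have h5 := Int.le_ceil (-(a / α) - r / |α|)
  have h6 : 0 ≤ r / |α| := by positivity
  refine h3.trans (max_le ?_ ?_)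
  · have : 2 * r / |α| = r / |α| + r / |α| := by ring
    linarith
  · have : 2 * r / |α| = r / |α| + r / |α| := by ring
    linarith

/-- Evaluation of the polynomial with coefficient vector `f`. -/
noncomputable def ev {d : ℕ} (f : Fin (d + 1) → ℤ) (t : ℂ) : ℂ := ∑ i, (f i : ℂ) * t ^ (i : ℕ)

theorem pow_lip (x y : ℂ) (hx : ‖x‖ ≤ 2) (hy : ‖y‖ ≤ 2) (n : ℕ) :
    ‖x ^ n - y ^ n‖ ≤ n * 2 ^ n * ‖x - y‖ := by
  induction n with
  | zero => simp
  | succ n ih =>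
    have h1 : x ^ (n + 1) - y ^ (n + 1) = x ^ n * (x - y) + (x ^ n - y ^ n) * y := by ring
    rw [h1]
    refine (norm_add_le _ _).trans ?_
    rw [norm_mul, norm_mul, norm_pow]
    have h2 : ‖x‖ ^ n ≤ 2 ^ n := pow_le_pow_left₀ (norm_nonneg _) hx n
    have h3 : ‖x‖ ^ n * ‖x - y‖ ≤ 2 ^ n * ‖x - y‖ := by gcongr
    have h4 : ‖x ^ n - y ^ n‖ * ‖y‖ ≤ n * 2 ^ n * ‖x - y‖ * 2 := by gcongr
    have h5 : 0 ≤ (2 : ℝ) ^ n * ‖x - y‖ := by positivity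
    push_cast
    rw [pow_succ]
    nlinarith

theorem ev_lip {d B : ℕ} (hB : 2 ≤ B) (f : Fin (d + 1) → ℤ) (hf : f ∈ box (Fin (d + 1)) B)
    (t τ : ℂ) (ht : ‖t‖ ≤ 1) (hτ : ‖t - τ‖ ≤ 2 / B) (h4 : ‖ev f t‖ ≤ 4) :
    ‖ev f τ‖ ≤ 4 + 2 * (d + 1) * (d * 2 ^ d) := by
  have hB' : (2 : ℝ) ≤ B := by exact_mod_cast hB
  have hτ2 : ‖τ‖ ≤ 2 := by
    have h1 : τ = t - (t - τ) := by ring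
    rw [h1]
    refine (norm_sub_le _ _).trans ?_
    have : 2 / (B : ℝ) ≤ 1 := by rw [div_le_one (by linarith)]; exact hB'
    linarith
  have hdiff : ‖ev f τ - ev f t‖ ≤ 2 * (d + 1) * (d * 2 ^ d) := by
    unfold ev
    rw [← Finset.sum_sub_distrib]
    refine (norm_sum_le _ _).trans ?_
    have hterm : ∀ i ∈ (Finset.univ : Finset (Fin (d + 1))),
        ‖(f i : ℂ) * τ ^ (i : ℕ) - (f i : ℂ) * t ^ (i : ℕ)‖ ≤ 2 * (d * 2 ^ d) := by
      intro i _
      rw [← mul_sub, norm_mul]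
      have h1 : ‖(f i : ℂ)‖ ≤ B := by
        rw [Complex.norm_intCast]
        have := Finset.mem_Icc.1 (mem_box.1 hf i)
        rw [abs_le]
        constructor
        · exact_mod_cast this.1
        · exact_mod_cast this.2
      have h2 := pow_lip τ t hτ2 (by linarith) i
      have h3 : ((i : ℕ) : ℝ) * 2 ^ (i : ℕ) ≤ d * 2 ^ d := by
        have hi : (i : ℕ) ≤ d := by omega
        have hi' : ((i : ℕ) : ℝ) ≤ d := by exact_mod_cast hi
        have : (2 : ℝ) ^ (i : ℕ) ≤ 2 ^ d := pow_le_pow_right₀ (by norm_num) hi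
        gcongr
      rw [norm_sub_rev τ t] at h2
      calc ‖(f i : ℂ)‖ * ‖τ ^ (i : ℕ) - t ^ (i : ℕ)‖
          ≤ B * ((d * 2 ^ d) * (2 / B)) := by
            gcongr
            exact h2.trans (by gcongr)
        _ = 2 * (d * 2 ^ d) := by field_simp
    refine (Finset.sum_le_card_nsmul _ _ _ hterm).trans ?_
    simp only [Finset.card_univ, Fintype.card_fin, nsmul_eq_mul]
    push_cast
    linarith
  have : ev f τ = ev f t + (ev f τ - ev f t) := by ring
  rw [this]
  exact (norm_add_le _ _).trans (by linarith)

/-- Grid point. -/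
noncomputable def grid (B : ℕ) (j k : ℤ) : ℂ := ⟨(j : ℝ) / B, (k : ℝ) / B⟩

open Classical in
/-- Vectors which are small at a grid point. -/
noncomputable def Nset (d B : ℕ) (r : ℝ) (j k : ℤ) : Finset (Fin (d + 1) → ℤ) :=
  (box (Fin (d + 1)) B).filter (fun f => ‖ev f (grid B j k)‖ ≤ r)

theorem ev_update {d : ℕ} (hd : 1 ≤ d) (g : Fin (d + 1) → ℤ) (t : ℂ) :
    ∃ q : ℂ, ∀ v w : ℤ, ev (Function.update (Function.update g 0 v) 1 w) t = v + w * t + q := by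
  obtain ⟨e, rfl⟩ : ∃ e, d = e + 1 := ⟨d - 1, by omega⟩
  refine ⟨∑ i : Fin e, (g i.succ.succ : ℂ) * t ^ ((i : ℕ) + 2), ?_⟩
  intro v w
  unfold ev
  rw [Fin.sum_univ_succ, Fin.sum_univ_succ]
  have h1 : (Fin.succ 0 : Fin (e + 1 + 1)) = 1 := rfl
  have h01 : (0 : Fin (e + 1 + 1)) ≠ 1 := by
    intro h; have := congrArg Fin.val h; simp at this
  have h2 : ∀ i : Fin e, i.succ.succ ≠ (1 : Fin (e + 1 + 1)) := by
    intro i h; have := congrArg Fin.val h; simp at this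
  have h3 : ∀ i : Fin e, i.succ.succ ≠ (0 : Fin (e + 1 + 1)) := by
    intro i h; have := congrArg Fin.val h; simp at this
  rw [h1]
  simp only [Function.update_self, Function.update_of_ne h01]
  simp only [Function.update_of_ne (h2 _), Function.update_of_ne (h3 _)]
  simp [add_assoc]

theorem card_Nset (d B : ℕ) (hd : 1 ≤ d) (hB : 2 ≤ B) (r : ℝ) (hr : 0 ≤ r) (j k : ℤ)
    (hk : k ∈ Finset.Icc (-(B : ℤ)) B) :
    ((Nset d B r j k).card : ℝ) ≤
      (2 * r + 1) * ((2 * r + 3) * B / max 1 |(k : ℝ)|) * (2 * B + 1) ^ (d - 1) := by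
  classical
  have hB' : (2 : ℝ) ≤ B := by exact_mod_cast hB
  have hB0 : (0 : ℝ) < B := by linarith
  set M0 : ℝ := 2 * r + 1 with hM0
  set M1 : ℝ := (2 * r + 3) * B / max 1 |(k : ℝ)| with hM1
  have hM1' : 0 ≤ M1 := by positivity
  have hkB : |(k : ℝ)| ≤ B := by
    rw [Finset.mem_Icc] at hk
    rw [abs_le]
    constructor
    · exact_mod_cast hk.1
    · exact_mod_cast hk.2
  have key : (Nset d B r j k).card ≤ (⌊M0⌋₊ * ⌊M1⌋₊) * (2 * B + 1) ^ (Fintype.card (Fin (d + 1)) - 2) := by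
    have h01 : (1 : Fin (d + 1)) ≠ 0 := by
      intro h; have := congrArg Fin.val h; simp at this; omega
    apply fiber_two B _ (Finset.filter_subset _ _) 0 1 h01
    intro g
    obtain ⟨q, hq⟩ := ev_update hd g (grid B j k)
    set T := (Finset.Icc (-(B : ℤ)) B ×ˢ Finset.Icc (-(B : ℤ)) B).filter
      (fun v => Function.update (Function.update g 0 v.1) 1 v.2 ∈ Nset d B r j k) with hT
    have hTmem : ∀ v ∈ T, v.2 ∈ Finset.Icc (-(B : ℤ)) B ∧
        |((1 : ℝ) * v.1 + (v.2 * (j / B) + q.re))| ≤ r ∧ |((k : ℝ) / B) * v.2 + q.im| ≤ r := by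
      intro v hv
      rw [hT, Finset.mem_filter, Finset.mem_product, Nset, Finset.mem_filter, hq] at hv
      obtain ⟨⟨_, hv2⟩, _, hv3⟩ := hv
      refine ⟨hv2, ?_, ?_⟩
      · have := (Complex.abs_re_le_norm _).trans hv3
        simp only [Complex.add_re, Complex.mul_re, Complex.intCast_re, Complex.intCast_im, grid,
          zero_mul, sub_zero] at this
        rw [one_mul, ← add_assoc]
        simpa using this
      · have := (Complex.abs_im_le_norm _).trans hv3
        simp only [Complex.add_im, Complex.mul_im, Complex.intCast_re, Complex.intCast_im, grid,
          zero_mul, add_zero, zero_add] at this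
        rw [mul_comm]
        simpa using this
    have himg : (T.image Prod.snd).card ≤ ⌊M1⌋₊ := by
      apply Nat.le_floor
      by_cases hk0 : k = 0
      · have h1 : (T.image Prod.snd).card ≤ 2 * B + 1 := by
          rw [← card_Icc_B]
          apply Finset.card_le_card
          intro w hw
          obtain ⟨v, hv, rfl⟩ := Finset.mem_image.1 hw
          exact (hTmem v hv).1
        have h2 : ((T.image Prod.snd).card : ℝ) ≤ 2 * B + 1 := by exact_mod_cast h1
        refine h2.trans ?_
        rw [hM1, hk0]
        simp
        nlinarith
      · have hk1 : (1 : ℝ) ≤ |(k : ℝ)| := by exact_mod_cast Int.one_le_abs hk0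
        have hkR : (k : ℝ) ≠ 0 := by exact_mod_cast hk0
        have h1 := card_interval (T.image Prod.snd) ((k : ℝ) / B) q.im r hr
          (div_ne_zero hkR hB0.ne') (by
            intro w hw
            obtain ⟨v, hv, rfl⟩ := Finset.mem_image.1 hw
            exact (hTmem v hv).2.2)
        refine h1.trans ?_
        rw [hM1, max_eq_right hk1, abs_div, abs_of_pos hB0]
        have hkp : 0 < |(k : ℝ)| := by linarith
        have e1 : 2 * r / (|(k : ℝ)| / B) + 1 = (2 * r * B + |(k : ℝ)|) / |(k : ℝ)| := by
          field_simp
        rw [e1]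
        apply div_le_div_of_nonneg_right _ hkp.le
        nlinarith
    have hfib : ∀ w ∈ T.image Prod.snd, (T.filter (fun v => v.2 = w)).card ≤ ⌊M0⌋₊ := by
      intro w _
      apply Nat.le_floor
      have hc : (T.filter (fun v => v.2 = w)).card
          = ((T.filter (fun v => v.2 = w)).image Prod.fst).card := by
        rw [Finset.card_image_of_injOn]
        intro a ha b hb hab
        rw [Finset.mem_coe, Finset.mem_filter] at ha hb
        exact Prod.ext hab (ha.2.trans hb.2.symm)
      rw [hc]
      have h1 := card_interval ((T.filter (fun v => v.2 = w)).image Prod.fst) 1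
        (w * (j / B) + q.re) r hr one_ne_zero (by
          intro u hu
          obtain ⟨v, hv, rfl⟩ := Finset.mem_image.1 hu
          rw [Finset.mem_filter] at hv
          rw [← hv.2]
          exact (hTmem v hv.1).2.1)
      simpa using h1
    exact (Finset.card_le_mul_card_image T _ hfib).trans (Nat.mul_le_mul_left _ himg)
  have h1 : ((Nset d B r j k).card : ℝ) ≤ ((⌊M0⌋₊ : ℝ) * ⌊M1⌋₊) * (2 * B + 1) ^ (d - 1) := by
    have : Fintype.card (Fin (d + 1)) - 2 = d - 1 := by simp
    rw [this] at key
    exact_mod_cast key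
  refine h1.trans ?_
  have h2 : (⌊M0⌋₊ : ℝ) ≤ M0 := Nat.floor_le (by positivity)
  have h3 : (⌊M1⌋₊ : ℝ) ≤ M1 := Nat.floor_le hM1'
  gcongr

end partC

section partD

theorem sum_inv_sq : ∃ S : ℝ, 0 < S ∧ ∀ B : ℕ,
    ∑ k ∈ Finset.Icc (-(B : ℤ)) B, 1 / (max 1 |(k : ℝ)|) ^ 2 ≤ S := by
  have hs : Summable (fun n : ℤ => 1 / (n : ℝ) ^ 2) :=
    Real.summable_one_div_int_pow.2 (by norm_num)
  have h0 : 0 ≤ ∑' n : ℤ, 1 / (n : ℝ) ^ 2 := tsum_nonneg (fun n => by positivity)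
  refine ⟨(∑' n : ℤ, 1 / (n : ℝ) ^ 2) + 1, by linarith, ?_⟩
  intro B
  have h1 : ∀ k ∈ Finset.Icc (-(B : ℤ)) B, 1 / (max 1 |(k : ℝ)|) ^ 2 ≤
      1 / (k : ℝ) ^ 2 + (if k = 0 then 1 else 0) := by
    intro k _
    by_cases hk : k = 0
    · subst hk; simp
    · have hk1 : (1 : ℝ) ≤ |(k : ℝ)| := by exact_mod_cast Int.one_le_abs hk
      rw [max_eq_right hk1, sq_abs, if_neg hk, add_zero]
  refine (Finset.sum_le_sum h1).trans ?_
  rw [Finset.sum_add_distrib]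
  apply add_le_add
  · exact hs.sum_le_tsum _ (fun n _ => by positivity)
  · rw [Finset.sum_ite_eq']
    split_ifs <;> norm_num

open Classical in
/-- Pairs of vectors in the box with a property. -/
noncomputable def Zset (d B : ℕ) (P : (Fin (d + 1) → ℤ) → (Fin (d + 1) → ℤ) → Prop) :
    Finset ((Fin (d + 1) → ℤ) × (Fin (d + 1) → ℤ)) :=
  (box (Fin (d + 1)) B ×ˢ box (Fin (d + 1)) B).filter (fun p => P p.1 p.2)

theorem mem_Zset {d B : ℕ} {P : (Fin (d + 1) → ℤ) → (Fin (d + 1) → ℤ) → Prop}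
    {p : (Fin (d + 1) → ℤ) × (Fin (d + 1) → ℤ)} :
    p ∈ Zset d B P ↔ (p.1 ∈ box (Fin (d + 1)) B ∧ p.2 ∈ box (Fin (d + 1)) B) ∧ P p.1 p.2 := by
  simp [Zset]

theorem card_Z5a (d : ℕ) (hd : 1 ≤ d) : ∃ C : ℝ, 0 ≤ C ∧ ∀ B : ℕ, 2 ≤ B →
    ((Zset d B (fun f g => ∃ t : ℂ, ‖t‖ ≤ 1 ∧ ‖ev f t‖ ≤ 4 ∧ ‖ev g t‖ ≤ 4)).card : ℝ) ≤
      C * (B : ℝ) ^ (2 * d + 1) := by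
  classical
  obtain ⟨S, hS, hSB⟩ := sum_inv_sq
  set r : ℝ := 4 + 2 * (d + 1) * (d * 2 ^ d) with hr
  have hr0 : 0 ≤ r := by positivity
  set K : ℝ := (2 * r + 1) * (2 * r + 3) with hK
  refine ⟨3 * K ^ 2 * S * 9 ^ (d - 1), by positivity, ?_⟩
  intro B hB
  have hB' : (2 : ℝ) ≤ B := by exact_mod_cast hB
  have hB0 : (0 : ℝ) < B := by linarith
  set I := Finset.Icc (-(B : ℤ)) B with hI
  have hsub : Zset d B (fun f g => ∃ t : ℂ, ‖t‖ ≤ 1 ∧ ‖ev f t‖ ≤ 4 ∧ ‖ev g t‖ ≤ 4) ⊆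
      (I ×ˢ I).biUnion (fun jk => Nset d B r jk.1 jk.2 ×ˢ Nset d B r jk.1 jk.2) := by
    intro p hp
    rw [mem_Zset] at hp
    obtain ⟨⟨hf, hg⟩, t, ht, h1, h2⟩ := hp
    have hfl : ∀ x : ℝ, |x| ≤ 1 → ⌊(B : ℝ) * x⌋ ∈ I ∧ |x - (⌊(B : ℝ) * x⌋ : ℝ) / B| ≤ 1 / B := by
      intro x hx
      rw [abs_le] at hx
      have a1 := Int.floor_le ((B : ℝ) * x)
      have a2 := Int.lt_floor_add_one ((B : ℝ) * x)
      constructor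
      · rw [hI, Finset.mem_Icc]
        constructor
        · rw [Int.le_floor]; push_cast; nlinarith
        · have : (⌊(B : ℝ) * x⌋ : ℝ) ≤ B := by nlinarith
          exact_mod_cast this
      · have e : x - (⌊(B : ℝ) * x⌋ : ℝ) / B = (B * x - ⌊(B : ℝ) * x⌋) / B := by field_simp
        rw [e, abs_div, abs_of_pos hB0]
        apply div_le_div_of_nonneg_right _ hB0.le
        rw [abs_le]; constructor <;> linarith
    obtain ⟨b1, b2⟩ := hfl t.re ((Complex.abs_re_le_norm t).trans ht)
    obtain ⟨c1, c2⟩ := hfl t.im ((Complex.abs_im_le_norm t).trans ht)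
    have hdist : ‖t - grid B ⌊(B : ℝ) * t.re⌋ ⌊(B : ℝ) * t.im⌋‖ ≤ 2 / B := by
      refine (Complex.norm_le_abs_re_add_abs_im _).trans ?_
      have : (2 : ℝ) / B = 1 / B + 1 / B := by ring
      rw [this]
      exact add_le_add b2 c2
    rw [Finset.mem_biUnion]
    refine ⟨(⌊(B : ℝ) * t.re⌋, ⌊(B : ℝ) * t.im⌋), Finset.mem_product.2 ⟨b1, c1⟩, ?_⟩
    rw [Finset.mem_product, Nset, Finset.mem_filter, Finset.mem_filter]
    exact ⟨⟨hf, ev_lip hB _ hf t _ ht hdist h1⟩, ⟨hg, ev_lip hB _ hg t _ ht hdist h2⟩⟩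
  have hc := (Finset.card_le_card hsub).trans Finset.card_biUnion_le
  have hc' : ((Zset d B (fun f g => ∃ t : ℂ, ‖t‖ ≤ 1 ∧ ‖ev f t‖ ≤ 4 ∧ ‖ev g t‖ ≤ 4)).card : ℝ) ≤
      ∑ jk ∈ I ×ˢ I, ((Nset d B r jk.1 jk.2).card : ℝ) * ((Nset d B r jk.1 jk.2).card : ℝ) := by
    have := (Nat.cast_le (α := ℝ)).2 hc
    simpa [Finset.card_product] using this
  refine hc'.trans ?_
  have hterm : ∀ jk ∈ I ×ˢ I,
      ((Nset d B r jk.1 jk.2).card : ℝ) * ((Nset d B r jk.1 jk.2).card : ℝ) ≤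
      (K ^ 2 * B ^ 2 * (9 ^ (d - 1) * B ^ (2 * (d - 1)))) * (1 / (max 1 |(jk.2 : ℝ)|) ^ 2) := by
    intro jk hjk
    have h1 := card_Nset d B hd hB r hr0 jk.1 jk.2 (Finset.mem_product.1 hjk).2
    have hm : 0 < max 1 |(jk.2 : ℝ)| := by positivity
    have h2 : ((2 : ℝ) * B + 1) ^ (d - 1) ≤ (3 * B) ^ (d - 1) := by
      apply pow_le_pow_left₀ (by positivity); linarith
    have h3 : ((Nset d B r jk.1 jk.2).card : ℝ) ≤
      (2 * r + 1) * ((2 * r + 3) * B / max 1 |(jk.2 : ℝ)|) * (3 * B) ^ (d - 1) :=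
      h1.trans (by gcongr)
    refine (mul_le_mul h3 h3 (by positivity) (by positivity)).trans (le_of_eq ?_)
    rw [hK, pow_mul, show (9 : ℝ) = 3 ^ 2 by norm_num, ← pow_mul, mul_comm 2 (d - 1), pow_mul,
      ← pow_mul (B : ℝ), mul_comm 2 (d - 1), pow_mul, mul_pow]
    field_simp
  refine (Finset.sum_le_sum hterm).trans ?_
  rw [← Finset.mul_sum, Finset.sum_product]
  simp only []
  rw [Finset.sum_const, hI, card_Icc_B, nsmul_eq_mul]
  have h5 := hSB B
  have h6 : ((2 * B + 1 : ℕ) : ℝ) ≤ 3 * B := by push_cast; linarith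
  calc _ ≤ K ^ 2 * B ^ 2 * (9 ^ (d - 1) * B ^ (2 * (d - 1))) * ((3 * B) * S) := by
        gcongr
    _ = _ := by
      have : 2 * d + 1 = 2 * (d - 1) + 3 := by omega
      rw [this, pow_add]
      ring

theorem ev_rev {d : ℕ} (f : Fin (d + 1) → ℤ) (t : ℂ) (ht : t ≠ 0) :
    ev (f ∘ Fin.rev) t⁻¹ = ev f t / t ^ d := by
  unfold ev
  rw [Finset.sum_div, ← Equiv.sum_comp Fin.revPerm]
  apply Finset.sum_congr rfl
  intro i _
  simp only [Fin.revPerm_apply, Function.comp, Fin.rev_rev]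
  have h : (Fin.rev i : ℕ) + i = d := by rw [Fin.val_rev]; omega
  have h2 : t ^ d = t ^ (Fin.rev i : ℕ) * t ^ (i : ℕ) := by rw [← pow_add, h]
  rw [h2, inv_pow]
  field_simp

theorem box_rev {d B : ℕ} {f : Fin (d + 1) → ℤ} (hf : f ∈ box (Fin (d + 1)) B) :
    f ∘ Fin.rev ∈ box (Fin (d + 1)) B := by
  rw [mem_box] at hf ⊢
  exact fun i => hf _

theorem card_Z5 (d : ℕ) (hd : 1 ≤ d) : ∃ C : ℝ, 0 ≤ C ∧ ∀ B : ℕ, 2 ≤ B →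
    ((Zset d B (fun f g => ∃ t : ℂ, ‖ev f t‖ ≤ 2 ∧ ‖ev g t‖ ≤ 4)).card : ℝ) ≤
      C * (B : ℝ) ^ (2 * d + 1) := by
  classical
  obtain ⟨C, hC, h⟩ := card_Z5a d hd
  refine ⟨2 * C, by positivity, ?_⟩
  intro B hB
  have h1 := h B hB
  set Z := Zset d B (fun f g => ∃ t : ℂ, ‖t‖ ≤ 1 ∧ ‖ev f t‖ ≤ 4 ∧ ‖ev g t‖ ≤ 4) with hZ
  have hsub : Zset d B (fun f g => ∃ t : ℂ, ‖ev f t‖ ≤ 2 ∧ ‖ev g t‖ ≤ 4) ⊆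
      Z ∪ Z.image (fun p => (p.1 ∘ Fin.rev, p.2 ∘ Fin.rev)) := by
    intro p hp
    rw [mem_Zset] at hp
    obtain ⟨⟨hf, hg⟩, t, h1, h2⟩ := hp
    rw [Finset.mem_union]
    by_cases ht : ‖t‖ ≤ 1
    · left
      rw [hZ, mem_Zset]
      exact ⟨⟨hf, hg⟩, t, ht, by linarith, h2⟩
    · right
      push Not at ht
      have ht0 : t ≠ 0 := by
        intro h; rw [h, norm_zero] at ht; linarith
      have hpow : 1 ≤ ‖t ^ d‖ := by rw [norm_pow]; exact one_le_pow₀ ht.le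
      rw [Finset.mem_image]
      refine ⟨(p.1 ∘ Fin.rev, p.2 ∘ Fin.rev), ?_, ?_⟩
      · rw [hZ, mem_Zset]
        refine ⟨⟨box_rev hf, box_rev hg⟩, t⁻¹, ?_, ?_, ?_⟩
        · rw [norm_inv]; exact inv_le_one_of_one_le₀ ht.le
        · simp only
          rw [ev_rev _ _ ht0, norm_div]
          exact (div_le_self (norm_nonneg _) hpow).trans (by linarith)
        · simp only
          rw [ev_rev _ _ ht0, norm_div]
          exact (div_le_self (norm_nonneg _) hpow).trans h2
      · have : ∀ f : Fin (d + 1) → ℤ, (f ∘ Fin.rev) ∘ Fin.rev = f := by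
          intro f; funext i; simp
        simp [this]
  have h2 := (Finset.card_le_card hsub).trans ((Finset.card_union_le _ _).trans
    (Nat.add_le_add_left Finset.card_image_le _))
  have h3 : ((Zset d B (fun f g => ∃ t : ℂ, ‖ev f t‖ ≤ 2 ∧ ‖ev g t‖ ≤ 4)).card : ℝ) ≤
      Z.card + Z.card := by exact_mod_cast h2
  linarith

theorem card_Z_fst (d B : ℕ) (P : (Fin (d + 1) → ℤ) → (Fin (d + 1) → ℤ) → Prop)
    (i₀ : Fin (d + 1)) (M : ℕ)
    (h : ∀ f g, ∃ T : Finset ℤ, T.card ≤ M ∧ ∀ v ∈ Finset.Icc (-(B : ℤ)) B,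
      P (Function.update f i₀ v) g → v ∈ T) :
    (Zset d B P).card ≤ M * (2 * B + 1) ^ (2 * d + 1) := by
  classical
  have h1 : (Zset d B P).card ≤ (M * (2 * B + 1) ^ d) * (box (Fin (d + 1)) B).card := by
    apply Finset.card_le_mul_card_image_of_maps_to (f := Prod.snd)
    · intro p hp
      exact (mem_Zset.1 hp).1.2
    · intro g hg
      have h2 : ((Zset d B P).filter (fun p => p.2 = g)).card ≤
          ((box (Fin (d + 1)) B).filter (fun f => P f g)).card := by
        apply Finset.card_le_card_of_injOn Prod.fst
        · intro p hp
          rw [Finset.mem_coe, Finset.mem_filter, mem_Zset] at hp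
          rw [Finset.mem_coe, Finset.mem_filter]
          obtain ⟨hp, rfl⟩ := hp
          exact ⟨hp.1.1, hp.2⟩
        · intro p hp q hq hpq
          rw [Finset.mem_coe, Finset.mem_filter] at hp hq
          exact Prod.ext hpq (hp.2.trans hq.2.symm)
      refine h2.trans ?_
      have h3 := fiber_one B ((box (Fin (d + 1)) B).filter (fun f => P f g))
        (Finset.filter_subset _ _) i₀ M (by
          intro f
          obtain ⟨T, hT, hT2⟩ := h f g
          refine le_trans (Finset.card_le_card ?_) hT
          intro v hv
          rw [Finset.mem_filter, Finset.mem_filter] at hv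
          exact hT2 v hv.1 hv.2.2)
      simpa using h3
  rw [card_box, Fintype.card_fin] at h1
  refine h1.trans (le_of_eq ?_)
  rw [mul_assoc, ← pow_add]
  congr 2
  ring

theorem card_Z_snd (d B : ℕ) (P : (Fin (d + 1) → ℤ) → (Fin (d + 1) → ℤ) → Prop)
    (i₀ : Fin (d + 1)) (M : ℕ)
    (h : ∀ f g, ∃ T : Finset ℤ, T.card ≤ M ∧ ∀ v ∈ Finset.Icc (-(B : ℤ)) B,
      P f (Function.update g i₀ v) → v ∈ T) :
    (Zset d B P).card ≤ M * (2 * B + 1) ^ (2 * d + 1) := by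
  refine le_trans ?_ (card_Z_fst d B (fun f g => P g f) i₀ M (fun f g => h g f))
  apply Finset.card_le_card_of_injOn Prod.swap
  · intro p hp
    rw [Finset.mem_coe, mem_Zset] at hp ⊢
    exact ⟨⟨hp.1.2, hp.1.1⟩, hp.2⟩
  · exact Prod.swap_injective.injOn

theorem card_Z1 (d B : ℕ) :
    (Zset d B (fun _ g => g (Fin.last d) = 0)).card ≤ 1 * (2 * B + 1) ^ (2 * d + 1) := by
  apply card_Z_snd d B _ (Fin.last d)
  intro f g
  refine ⟨{0}, by simp, ?_⟩
  intro v _ hv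
  simpa using hv

theorem card_Z2 (d B : ℕ) :
    (Zset d B (fun f g => g (Fin.last d) = f (Fin.last d))).card ≤
      1 * (2 * B + 1) ^ (2 * d + 1) := by
  apply card_Z_snd d B _ (Fin.last d)
  intro f g
  refine ⟨{f (Fin.last d)}, by simp, ?_⟩
  intro v _ hv
  simpa using hv

theorem card_Z3 (d B : ℕ) (hd : 1 ≤ d) :
    (Zset d B (fun f g => (g (Fin.last d) ≠ 0 ∧ g (Fin.last d) ≠ f (Fin.last d)) ∧
      4 * (g (Fin.last d) - f (Fin.last d)) ^ 2 * g 0 = g (Fin.last d) ^ 2 +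
        4 * g (Fin.last d) * (g (Fin.last d) - f (Fin.last d)) * (g 0 - f 0))).card ≤
      1 * (2 * B + 1) ^ (2 * d + 1) := by
  classical
  apply card_Z_fst d B _ 0
  intro f g
  have h0 : Fin.last d ≠ 0 := by
    intro h; have := congrArg Fin.val h; simp at this; omega
  refine ⟨(Finset.Icc (-(B : ℤ)) B).filter (fun v =>
    (g (Fin.last d) ≠ 0 ∧ g (Fin.last d) ≠ f (Fin.last d)) ∧
      4 * (g (Fin.last d) - f (Fin.last d)) ^ 2 * g 0 = g (Fin.last d) ^ 2 +
        4 * g (Fin.last d) * (g (Fin.last d) - f (Fin.last d)) * (g 0 - v)), ?_, ?_⟩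
  · rw [Finset.card_le_one]
    intro a ha b hb
    rw [Finset.mem_filter] at ha hb
    obtain ⟨_, ⟨h1, h2⟩, ha⟩ := ha
    obtain ⟨_, _, hb⟩ := hb
    have h3 : g (Fin.last d) - f (Fin.last d) ≠ 0 := sub_ne_zero.2 h2
    have h4 : (4 * g (Fin.last d) * (g (Fin.last d) - f (Fin.last d))) * (b - a) = 0 := by
      linear_combination hb - ha
    rcases mul_eq_zero.1 h4 with h | h
    · exact absurd h (mul_ne_zero (mul_ne_zero (by norm_num) h1) h3)
    · linarith
  · intro v hv h
    rw [Finset.mem_filter]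
    refine ⟨hv, ?_⟩
    simpa [Function.update_of_ne h0] using h

theorem card_Z4 (d B : ℕ) :
    (Zset d B (fun _ g => IsSquare (-(g 0)))).card ≤
      (Nat.sqrt B + 1) * (2 * B + 1) ^ (2 * d + 1) := by
  classical
  apply card_Z_snd d B _ 0
  intro f g
  refine ⟨(Finset.range (Nat.sqrt B + 1)).image (fun n : ℕ => -((n : ℤ) * n)), ?_, ?_⟩
  · exact Finset.card_image_le.trans (by simp)
  · intro v hv h
    rw [Function.update_self] at h
    obtain ⟨s, hs⟩ := h
    rw [Finset.mem_image]
    refine ⟨s.natAbs, ?_, ?_⟩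
    · rw [Finset.mem_range, Nat.lt_succ_iff, Nat.le_sqrt]
      have h1 := (Finset.mem_Icc.1 hv).1
      have h2 : ((s.natAbs * s.natAbs : ℕ) : ℤ) ≤ B := by
        rw [Int.natAbs_mul_self]; linarith
      exact_mod_cast h2
    · rw [← Nat.cast_mul, Int.natAbs_mul_self]; linarith

theorem ev_ofFn {d : ℕ} (f : Fin (d + 1) → ℤ) (t : ℂ) :
    ((Polynomial.ofFn (d + 1) f).map (Int.castRingHom ℂ)).eval t = ev f t := by
  rw [Polynomial.ofFn_eq_sum_monomial, Polynomial.map_sum, Polynomial.eval_finsetSum]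
  unfold ev
  apply Finset.sum_congr rfl
  intro i _
  simp

/-- The exceptional pairs. -/
def BadP {d : ℕ} (f g : Fin (d + 1) → ℤ) : Prop :=
  g (Fin.last d) = 0 ∨ g (Fin.last d) = f (Fin.last d) ∨
  ((g (Fin.last d) ≠ 0 ∧ g (Fin.last d) ≠ f (Fin.last d)) ∧
      4 * (g (Fin.last d) - f (Fin.last d)) ^ 2 * g 0 = g (Fin.last d) ^ 2 +
        4 * g (Fin.last d) * (g (Fin.last d) - f (Fin.last d)) * (g 0 - f 0)) ∨
  IsSquare (-(g 0)) ∨ ∃ t : ℂ, ‖ev f t‖ ≤ 2 ∧ ‖ev g t‖ ≤ 4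

theorem surj_of_not_bad {d : ℕ} (hd : 1 ≤ d) (f g : Fin (d + 1) → ℤ) (h : ¬ BadP f g) :
    IsSurjPair (Polynomial.ofFn (d + 1) f) (Polynomial.ofFn (d + 1) g) := by
  unfold BadP at h
  push Not at h
  obtain ⟨h1, h2, h3, h4, h5⟩ := h
  have hl : ∀ f : Fin (d + 1) → ℤ, (Polynomial.ofFn (d + 1) f).coeff d = f (Fin.last d) := by
    intro f
    rw [Polynomial.ofFn_coeff_eq_val_of_lt _ (Nat.lt_succ_self d)]
    rfl
  have hz : ∀ f : Fin (d + 1) → ℤ, (Polynomial.ofFn (d + 1) f).coeff 0 = f 0 := by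
    intro f
    rw [Polynomial.ofFn_coeff_eq_val_of_lt _ (Nat.succ_pos d)]
    rfl
  have hdeg : ∀ f : Fin (d + 1) → ℤ, (Polynomial.ofFn (d + 1) f).natDegree ≤ d := by
    intro f
    exact Nat.lt_succ_iff.1 (Polynomial.ofFn_natDegree_lt (Nat.succ_pos d) f)
  apply surj_of_conditions d hd _ _ (hdeg f) (hdeg g)
  · rw [hl]; exact h1
  · rw [hl, hl]; exact h2
  · rw [hl, hl, hz, hz]; exact h3 ⟨h1, h2⟩
  · rw [hz]; exact h4
  · intro t ht
    rw [ev_ofFn, ev_ofFn] at ht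
    exact absurd ht.2 (not_le.2 (h5 t ht.1))

theorem card_bad (d : ℕ) (hd : 1 ≤ d) : ∃ C : ℝ, 0 ≤ C ∧ ∀ B : ℕ, 2 ≤ B →
    ((Zset d B BadP).card : ℝ) ≤ C * (B : ℝ) ^ (2 * d + 1) * √B := by
  classical
  obtain ⟨C, hC, h5⟩ := card_Z5 d hd
  refine ⟨5 * 3 ^ (2 * d + 1) + C, by positivity, ?_⟩
  intro B hB
  have hB' : (2 : ℝ) ≤ B := by exact_mod_cast hB
  have hsq : 1 ≤ √(B : ℝ) := by
    rw [Real.one_le_sqrt]; linarith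
  have hsub : Zset d B BadP ⊆
      Zset d B (fun _ g => g (Fin.last d) = 0) ∪
      (Zset d B (fun f g => g (Fin.last d) = f (Fin.last d)) ∪
      (Zset d B (fun f g => (g (Fin.last d) ≠ 0 ∧ g (Fin.last d) ≠ f (Fin.last d)) ∧
      4 * (g (Fin.last d) - f (Fin.last d)) ^ 2 * g 0 = g (Fin.last d) ^ 2 +
        4 * g (Fin.last d) * (g (Fin.last d) - f (Fin.last d)) * (g 0 - f 0)) ∪
      (Zset d B (fun _ g => IsSquare (-(g 0))) ∪
      Zset d B (fun f g => ∃ t : ℂ, ‖ev f t‖ ≤ 2 ∧ ‖ev g t‖ ≤ 4)))) := by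
    intro p hp
    simp only [Finset.mem_union, mem_Zset] at hp ⊢
    obtain ⟨hp, h⟩ := hp
    rcases h with h | h | h | h | h
    · exact Or.inl ⟨hp, h⟩
    · exact Or.inr (Or.inl ⟨hp, h⟩)
    · exact Or.inr (Or.inr (Or.inl ⟨hp, h⟩))
    · exact Or.inr (Or.inr (Or.inr (Or.inl ⟨hp, h⟩)))
    · exact Or.inr (Or.inr (Or.inr (Or.inr ⟨hp, h⟩)))
  have hc := (Finset.card_le_card hsub).trans ((Finset.card_union_le _ _).trans
    (Nat.add_le_add (card_Z1 d B) ((Finset.card_union_le _ _).trans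
    (Nat.add_le_add (card_Z2 d B) ((Finset.card_union_le _ _).trans
    (Nat.add_le_add (card_Z3 d B hd) ((Finset.card_union_le _ _).trans
    (Nat.add_le_add (card_Z4 d B) le_rfl))))))))
  have hc' := (Nat.cast_le (α := ℝ)).2 hc
  push_cast at hc'
  have h5' := h5 B hB
  have hs : (Nat.sqrt B : ℝ) ≤ √(B : ℝ) := Real.nat_sqrt_le_real_sqrt
  have hp : ((2 : ℝ) * B + 1) ^ (2 * d + 1) ≤ 3 ^ (2 * d + 1) * B ^ (2 * d + 1) := by
    rw [← mul_pow]
    apply pow_le_pow_left₀ (by positivity); linarith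
  set X : ℝ := ((2 : ℝ) * B + 1) ^ (2 * d + 1) with hX
  have hX0 : 0 ≤ X := by positivity
  set Y : ℝ := (B : ℝ) ^ (2 * d + 1) with hY
  have hY0 : 0 ≤ Y := by positivity
  have e1 : ((Nat.sqrt B : ℝ) + 1) * X ≤ (2 * √(B : ℝ)) * X := by
    apply mul_le_mul_of_nonneg_right _ hX0; linarith
  have e2 : X ≤ √(B : ℝ) * X := le_mul_of_one_le_left hX0 hsq
  have e3 : C * Y ≤ √(B : ℝ) * (C * Y) := le_mul_of_one_le_left (by positivity) hsq
  have e4 : √(B : ℝ) * X ≤ √(B : ℝ) * (3 ^ (2 * d + 1) * Y) := by gcongr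
  have e5 : (5 * 3 ^ (2 * d + 1) + C) * Y * √(B : ℝ) =
    5 * (√(B : ℝ) * (3 ^ (2 * d + 1) * Y)) + √(B : ℝ) * (C * Y) := by ring
  rw [e5]
  linarith

theorem card_SurSet (d B : ℕ) (hd : 1 ≤ d) :
    Nat.card (SurSet d B) ≤ (2 * B + 1) ^ (2 * d + 2) ∧
    (2 * B + 1) ^ (2 * d + 2) ≤ Nat.card (SurSet d B) + (Zset d B BadP).card := by
  classical
  set Bx := box (Fin (d + 1)) B ×ˢ box (Fin (d + 1)) B with hBx
  have hcard : Bx.card = (2 * B + 1) ^ (2 * d + 2) := by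
    rw [hBx, Finset.card_product, card_box, Fintype.card_fin, ← pow_add]
    congr 1
    ring
  set F : (Fin (d + 1) → ℤ) × (Fin (d + 1) → ℤ) → ℤ[X] × ℤ[X] :=
    fun p => (Polynomial.ofFn (d + 1) p.1, Polynomial.ofFn (d + 1) p.2) with hF
  have hinj : Function.Injective F := by
    intro p q hpq
    rw [hF] at hpq
    simp only [Prod.mk.injEq] at hpq
    exact Prod.ext (Polynomial.injective_ofFn _ hpq.1) (Polynomial.injective_ofFn _ hpq.2)
  have hdeg : ∀ f : Fin (d + 1) → ℤ, (Polynomial.ofFn (d + 1) f).natDegree ≤ d := by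
    intro f
    exact Nat.lt_succ_iff.1 (Polynomial.ofFn_natDegree_lt (Nat.succ_pos d) f)
  have hsub1 : SurSet d B ⊆ (Bx.image F : Finset (ℤ[X] × ℤ[X])) := by
    intro p hp
    obtain ⟨h1, h2, h3, h4, _⟩ := hp
    rw [Finset.mem_coe, Finset.mem_image]
    refine ⟨(Polynomial.toFn (d + 1) p.1, Polynomial.toFn (d + 1) p.2), ?_, ?_⟩
    · rw [hBx, Finset.mem_product, mem_box, mem_box]
      constructor
      · intro i
        rw [Finset.mem_Icc]
        exact abs_le.1 (h3 i)
      · intro i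
        rw [Finset.mem_Icc]
        exact abs_le.1 (h4 i)
    · rw [hF]
      exact Prod.ext (Polynomial.ofFn_comp_toFn_eq_id_of_natDegree_lt (Nat.lt_succ_iff.2 h1))
        (Polynomial.ofFn_comp_toFn_eq_id_of_natDegree_lt (Nat.lt_succ_iff.2 h2))
  have hfin : (SurSet d B).Finite := (Finset.finite_toSet _).subset hsub1
  have hco : ∀ f ∈ box (Fin (d + 1)) B, ∀ i, |(Polynomial.ofFn (d + 1) f).coeff i| ≤ (B : ℤ) := by
    intro f hf i
    by_cases hi : i < d + 1
    · rw [Polynomial.ofFn_coeff_eq_val_of_lt _ hi, abs_le]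
      exact Finset.mem_Icc.1 (mem_box.1 hf _)
    · rw [Polynomial.ofFn_coeff_eq_zero_of_ge _ (not_lt.1 hi)]
      simp
  have hsub2 : (((Bx \ Zset d B BadP).image F : Finset (ℤ[X] × ℤ[X])) : Set (ℤ[X] × ℤ[X])) ⊆
      SurSet d B := by
    intro p hp
    rw [Finset.mem_coe, Finset.mem_image] at hp
    obtain ⟨q, hq, rfl⟩ := hp
    rw [Finset.mem_sdiff, mem_Zset, hBx, Finset.mem_product] at hq
    refine ⟨hdeg _, hdeg _, hco _ hq.1.1, hco _ hq.1.2, ?_⟩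
    exact surj_of_not_bad hd _ _ (fun h => hq.2 ⟨hq.1, h⟩)
  have hn : Nat.card (SurSet d B) = (SurSet d B).ncard := rfl
  rw [hn]
  constructor
  · have := Set.ncard_le_ncard hsub1 (Finset.finite_toSet _)
    rw [Set.ncard_coe_finset, Finset.card_image_of_injective _ hinj, hcard] at this
    exact this
  · have := Set.ncard_le_ncard hsub2 hfin
    rw [Set.ncard_coe_finset, Finset.card_image_of_injective _ hinj] at this
    have h2 := Finset.le_card_sdiff (Zset d B BadP) Bx
    rw [hcard] at h2
    omega

end partD

/-- `#Sur_d(B) = (2B+1)^{2d+2} + O(B^{2d+2-1/2} log B)`. -/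
theorem stmt_10 (d : ℕ) (hd : 1 ≤ d) :
    ∃ Cst : ℝ, 0 < Cst ∧ ∀ B : ℕ, 2 ≤ B →
      |(Nat.card (SurSet d B) : ℝ) - (2 * (B : ℝ) + 1) ^ (2 * d + 2)| ≤
        Cst * (B : ℝ) ^ (2 * (d : ℝ) + 3 / 2) * Real.log B := by
  obtain ⟨C, hC, h⟩ := card_bad d hd
  have hl2 : 0 < Real.log 2 := Real.log_pos (by norm_num)
  refine ⟨(C + 1) / Real.log 2, by positivity, ?_⟩
  intro B hB
  have hB' : (2 : ℝ) ≤ B := by exact_mod_cast hB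
  have hB0 : (0 : ℝ) < B := by linarith
  obtain ⟨h1, h2⟩ := card_SurSet d B hd
  have h1' : (Nat.card (SurSet d B) : ℝ) ≤ (2 * (B : ℝ) + 1) ^ (2 * d + 2) := by exact_mod_cast h1
  have h2' : (2 * (B : ℝ) + 1) ^ (2 * d + 2) ≤
      (Nat.card (SurSet d B) : ℝ) + ((Zset d B BadP).card : ℝ) := by exact_mod_cast h2
  have h3 := h B hB
  have hpow : (B : ℝ) ^ (2 * (d : ℝ) + 3 / 2) = (B : ℝ) ^ (2 * d + 1) * √B := by
    rw [Real.sqrt_eq_rpow, ← Real.rpow_natCast, ← Real.rpow_add hB0]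
    congr 1
    push_cast
    ring
  have hlog : Real.log 2 ≤ Real.log B := Real.log_le_log (by norm_num) hB'
  have hW : 0 ≤ (B : ℝ) ^ (2 * d + 1) * √B := by positivity
  rw [hpow, abs_le]
  set W := (B : ℝ) ^ (2 * d + 1) * √B with hWdef
  have h4 : ((Zset d B BadP).card : ℝ) ≤ C * W := by rw [hWdef, ← mul_assoc]; exact h3
  have h5 : C * W ≤ (C + 1) / Real.log 2 * W * Real.log B := by
    have e : (C + 1) / Real.log 2 * W * Real.log B = (C + 1) * W * (Real.log B / Real.log 2) := by
      ring
    rw [e]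
    have h6 : 1 ≤ Real.log B / Real.log 2 := by rw [one_le_div hl2]; exact hlog
    have h7 : (C + 1) * W ≤ (C + 1) * W * (Real.log B / Real.log 2) :=
      le_mul_of_one_le_right (by positivity) h6
    linarith
  constructor
  · linarith
  · have : 0 ≤ C * W := by positivity
    linarith
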